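/- Let T be an ℝ-tree with a very small, minimal, isometric action of the free group F_N (N ≥ 2) with dense orbits, let 𝒜 be a basis of F_N, and let K ⊆ T̄ be a compact subtree with K ∩ aK ≠ ∅ for every a ∈ 𝒜; let 𝒦 = (K,𝒜) be the induced system of isometries. Then the following are equivalent: (1) the restriction of the canonical F_N-equivariant morphism j : T_𝒦 → T̄ to the minimal F_N-invariant subtree T_𝒦^min of T_𝒦 is an F_N-equivariant isometry onto T; (2) ℒ_𝒜(T) ⊆ ℒ_adm(𝒦); (3) Ω_𝒜 ⊆ K. -/

import Mathlib

/-!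
Common formalization framework for "ℝ-trees, dual laminations, and compact systems
of partial isometries" (Coulbois–Hilion–Lustig).
-/

open Set Filter Topology Pointwise

noncomputable section

namespace CHL

/-! ### ℝ-trees -/

/-- The metric betweenness segment `[x,y]`.  In an ℝ-tree this is exactly the unique
topological arc joining `x` to `y`, which is a geodesic segment. -/
def seg {T : Type*} [MetricSpace T] (x y : T) : Set T :=
  {z | dist x z + dist z y = dist x y}

/-- An ℝ-tree: a geodesic metric space which is `0`-hyperbolic (four point condition).
Equivalently, any two points are joined by a unique topological arc, and this arc is a
geodesic segment. -/
class IsRTree (T : Type*) [MetricSpace T] : Prop where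
  geodesic : ∀ x y : T, ∃ f : ℝ → T, f 0 = x ∧ f (dist x y) = y ∧
      ∀ s ∈ Set.Icc (0 : ℝ) (dist x y), ∀ t ∈ Set.Icc (0 : ℝ) (dist x y),
        dist (f s) (f t) = |s - t|
  four_point : ∀ x y z w : T,
      dist x y + dist z w ≤ max (dist x z + dist y w) (dist x w + dist y z)

/-- A subtree of an ℝ-tree: a convex subset. -/
def IsSubtree {T : Type*} [MetricSpace T] (A : Set T) : Prop :=
  ∀ x ∈ A, ∀ y ∈ A, seg x y ⊆ A

/-- A non-empty closed subtree. -/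
def IsClosedSubtree {T : Type*} [MetricSpace T] (A : Set T) : Prop :=
  A.Nonempty ∧ IsClosed A ∧ IsSubtree A

/-- The convex hull of a subset of an ℝ-tree: the smallest subtree containing it. -/
def subtreeHull {T : Type*} [MetricSpace T] (S : Set T) : Set T :=
  ⋂₀ {A : Set T | S ⊆ A ∧ IsSubtree A}

/-- A finite tree: the convex hull of finitely many points. -/
def IsFiniteSubtree {T : Type*} [MetricSpace T] (A : Set T) : Prop :=
  ∃ F : Finset T, A = subtreeHull (F : Set T)

/-- `[x,x']` is the segment joining `A` to `B`: its endpoints are the only points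
in `A` resp. `B` that it meets. -/
def IsBridge {T : Type*} [MetricSpace T] (A B : Set T) (x x' : T) : Prop :=
  x ∈ A ∧ x' ∈ B ∧ seg x x' ∩ A = {x} ∧ seg x x' ∩ B = {x'}

/-- A morphism of ℝ-trees: a continuous map such that every segment is mapped locally
injectively except at finitely many points. -/
def IsTreeMorphism {T T' : Type*} [MetricSpace T] [MetricSpace T'] (f : T → T') : Prop :=
  Continuous f ∧ ∀ x y : T, ∃ F : Finset T, ∀ p ∈ seg x y, p ∉ (F : Set T) →
    ∃ U ∈ nhdsWithin p (seg x y), Set.InjOn f U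

/-- The translation length `‖g‖_T = inf_{x ∈ T} d(x, gx)`. -/
def translationLength (G : Type*) [Group G] (T : Type*) [MetricSpace T] [MulAction G T]
    (g : G) : ℝ :=
  ⨅ x : T, dist x (g • x)

/-- The translation length of `g` on an invariant subtree `A`. -/
def translationLengthOn {G : Type*} [Group G] {T : Type*} [MetricSpace T] [MulAction G T]
    (A : Set T) (g : G) : ℝ :=
  ⨅ x : A, dist (x : T) (g • (x : T))

/-- The minimal `G`-invariant subtree. -/
def minSubtree (G : Type*) [Group G] (T : Type*) [MetricSpace T] [MulAction G T] : Set T :=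
  ⋂₀ {A : Set T | A.Nonempty ∧ IsSubtree A ∧ ∀ g : G, ∀ x ∈ A, g • x ∈ A}

/-! ### Free groups, reduced words and the boundary `∂F(𝒜)` -/

/-- Two letters of `𝒜^{±1}` are inverse to each other. -/
def LettersInv {ι : Type*} (a b : ι × Bool) : Prop := a.1 = b.1 ∧ a.2 = !b.2

/-- The prefix of length `n` of (the reduced word of) `w`. -/
def gprefix {ι : Type*} [DecidableEq ι] (w : FreeGroup ι) (n : ℕ) : FreeGroup ι :=
  FreeGroup.mk (w.toWord.take n)

/-- An infinite reduced word in the letters `𝒜^{±1}`: a point of the Gromov boundary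
`∂F(𝒜)` of the free group `F(𝒜)`. -/
structure InfWord (ι : Type*) where
  letter : ℕ → ι × Bool
  reduced : ∀ n, ¬ LettersInv (letter n) (letter (n + 1))

/-- The prefix `X_n` of length `n` of an infinite reduced word `X`. -/
def InfWord.prefixN {ι : Type*} (X : InfWord ι) (n : ℕ) : FreeGroup ι :=
  FreeGroup.mk (List.ofFn fun i : Fin n => X.letter i)

/-- The infinite word `X_k⁻¹ X` obtained by deleting the first `k` letters. -/
def InfWord.shift {ι : Type*} (X : InfWord ι) (k : ℕ) : InfWord ι :=
  ⟨fun n => X.letter (k + n), fun n => X.reduced (k + n)⟩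

/-- A sequence `wₙ ∈ F(𝒜)` converges in `F(𝒜) ∪ ∂F(𝒜)` to the infinite word `X` iff
the length of the maximal common prefix of `wₙ` and `X` tends to infinity. -/
def TendstoBoundary {ι : Type*} [DecidableEq ι] (w : ℕ → FreeGroup ι) (X : InfWord ι) : Prop :=
  ∀ k : ℕ, ∀ᶠ n in atTop, (w n).toWord.take k = List.ofFn fun i : Fin k => X.letter i

/-- `Y = w · X` for the left action of `F(𝒜)` on its boundary `∂F(𝒜)`. -/
def SmulBoundary {ι : Type*} [DecidableEq ι] (w : FreeGroup ι) (X Y : InfWord ι) : Prop :=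
  TendstoBoundary (fun n => w * X.prefixN n) Y

/-- The (Cantor set) topology on `∂F(𝒜)`, induced by the product topology on sequences
of letters. -/
instance {ι : Type*} : TopologicalSpace (InfWord ι) :=
  TopologicalSpace.induced (fun X => X.letter)
    (@Pi.topologicalSpace ℕ (fun _ => ι × Bool) fun _ => ⊥)

/-- A non-trivial element of `F(𝒜)` is cyclically reduced if the first letter of its reduced
word is not the inverse of its last letter. -/
def IsCyclicallyReduced {ι : Type*} [DecidableEq ι] (w : FreeGroup ι) : Prop :=
  w ≠ 1 ∧ ∀ a ∈ w.toWord.head?, ∀ b ∈ w.toWord.getLast?, ¬ LettersInv a b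

/-- The dual laminary language `ℒ_𝒜(T)` of an isometric action of `F(𝒜)` on `T`. -/
def dualLanguage (ι : Type*) [DecidableEq ι] (T : Type*) [MetricSpace T]
    [MulAction (FreeGroup ι) T] : Set (FreeGroup ι) :=
  {v | ∀ ε > (0 : ℝ), ∃ u w : FreeGroup ι,
      (u * v * w).toWord = u.toWord ++ v.toWord ++ w.toWord ∧
      IsCyclicallyReduced (u * v * w) ∧
      translationLength (FreeGroup ι) T (u * v * w) < ε}

/-- The dual laminary language `ℒ_𝒜(T)`, for the action restricted to an invariant
subtree `A`. -/
def dualLanguageOn (ι : Type*) [DecidableEq ι] {T : Type*} [MetricSpace T]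
    [MulAction (FreeGroup ι) T] (A : Set T) : Set (FreeGroup ι) :=
  {v | ∀ ε > (0 : ℝ), ∃ u w : FreeGroup ι,
      (u * v * w).toWord = u.toWord ++ v.toWord ++ w.toWord ∧
      IsCyclicallyReduced (u * v * w) ∧
      translationLengthOn A (u * v * w) < ε}

/-! ### Systems of isometries on a compact ℝ-tree -/

/-- A system of isometries `𝒦 = (K, 𝒜)`: a family, indexed by `ι`, of non-empty partial
isometries of the compact ℝ-tree `K`, i.e. isometries between non-empty closed subtrees. -/
structure SystemOfIsometries (K : Type*) [MetricSpace K] (ι : Type*) where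
  pe : ι → PartialEquiv K K
  isom : ∀ i, ∀ x ∈ (pe i).source, ∀ y ∈ (pe i).source, dist (pe i x) (pe i y) = dist x y
  source_subtree : ∀ i, IsClosedSubtree (pe i).source
  target_subtree : ∀ i, IsClosedSubtree (pe i).target

namespace SystemOfIsometries

variable {K : Type*} [MetricSpace K] {ι : Type*} (S : SystemOfIsometries K ι)

/-- The partial isometry associated to a letter in `𝒜^{±1}`. -/
def letterPE : ι × Bool → PartialEquiv K K
  | (i, true) => S.pe i
  | (i, false) => (S.pe i).symm

/-- The partial isometry `z₁ ∘ z₂ ∘ ⋯ ∘ zₙ` (acting on the right: first `z₁`, then `z₂`, …)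
associated to the reduced word `w = z₁ ⋯ zₙ ∈ F(𝒜)`. -/
def wordPE [DecidableEq ι] (w : FreeGroup ι) : PartialEquiv K K :=
  (w.toWord.map S.letterPE).foldl PartialEquiv.trans (PartialEquiv.refl K)

/-- The domain `dom (w)` of the partial isometry associated to `w`. -/
def dom [DecidableEq ι] (w : FreeGroup ι) : Set K := (S.wordPE w).source

/-- A word is admissible if it is non-empty as a partial isometry of `K`. -/
def Admissible [DecidableEq ι] (w : FreeGroup ι) : Prop := (S.dom w).Nonempty

/-- An infinite word is admissible if all its prefixes are admissible. -/
def AdmissibleInf [DecidableEq ι] (X : InfWord ι) : Prop := ∀ n, S.Admissible (X.prefixN n)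

/-- The domain of an infinite word: the intersection of the domains of its prefixes. -/
def domInf [DecidableEq ι] (X : InfWord ι) : Set K := ⋂ n, S.dom (X.prefixN n)

/-- An infinite word `X` is eventually admissible if some suffix `X_k⁻¹ X` is admissible. -/
def EventuallyAdmissible [DecidableEq ι] (X : InfWord ι) : Prop :=
  ∃ k, S.AdmissibleInf (X.shift k)

/-- The system `𝒦` has independent generators if the (non-empty) domain of every
admissible infinite word consists of exactly one point. -/
def IndependentGenerators [DecidableEq ι] : Prop :=
  ∀ X : InfWord ι, S.AdmissibleInf X → ∃ x : K, S.domInf X = {x}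

/-- The admissible laminary language `ℒ_adm(𝒦)`: the largest laminary language consisting of
admissible words; `w ∈ ℒ_adm(𝒦)` iff for every `k` the word `w` is obtained from some
admissible word `v` by deleting its prefix and its suffix of length `k`. -/
def admLanguage [DecidableEq ι] : Set (FreeGroup ι) :=
  {w | ∀ k : ℕ, ∃ v : FreeGroup ι, S.Admissible v ∧
      ∃ p s : List (ι × Bool), p.length = k ∧ s.length = k ∧
        v.toWord = p ++ w.toWord ++ s}

end SystemOfIsometries

/-- The ℝ-tree `T_𝒦` associated to a system of isometries `𝒦 = (K, 𝒜)`, presented through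
its characteristic properties (Theorem 3.2 of the paper, by which it is unique):
`T_𝒦` contains `K` as an isometrically embedded subtree (1); the left action of `F(𝒜)`
is compatible with the partial isometries (2); every orbit meets `K`, and indeed every
segment is covered by finitely many translates of `K` (3); and `T_𝒦` is universal among
trees satisfying (1) and (2), via unique equivariant morphisms (4). -/
structure AssocTree {K : Type} [MetricSpace K] {ι : Type} [DecidableEq ι]
    (S : SystemOfIsometries K ι) where
  carrier : Type
  [ms : MetricSpace carrier]
  tree : IsRTree carrier
  [act : MulAction (FreeGroup ι) carrier]
  act_isom : ∀ g : FreeGroup ι, Isometry fun x : carrier => g • x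
  emb : K → carrier
  emb_isom : Isometry emb
  emb_subtree : IsSubtree (Set.range emb)
  compat : ∀ i : ι, ∀ x ∈ (S.pe i).source, (FreeGroup.of i)⁻¹ • emb x = emb (S.pe i x)
  orbit_meets : ∀ p : carrier, ∃ (w : FreeGroup ι) (x : K), p = w • emb x
  seg_cover : ∀ p q : carrier, ∃ F : Finset (FreeGroup ι),
      seg p q ⊆ ⋃ w ∈ F, w • Set.range emb
  universal : ∀ (T' : Type) [MetricSpace T'] [MulAction (FreeGroup ι) T'],
      (∀ g : FreeGroup ι, Isometry fun x : T' => g • x) →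
      ∀ e' : K → T', Isometry e' →
      (∀ i : ι, ∀ x ∈ (S.pe i).source, (FreeGroup.of i)⁻¹ • e' x = e' (S.pe i x)) →
      ∃! f : carrier → T', IsTreeMorphism f ∧
        (∀ (g : FreeGroup ι) (p : carrier), f (g • p) = g • f p) ∧
        ∀ x : K, f (emb x) = e' x

attribute [instance] AssocTree.ms AssocTree.act

/-! ### Very small minimal actions with dense orbits, and their metric completion -/

/-- An ℝ-tree `T` (here: the subtree `Tsub` of the complete ℝ-tree `Tb`, whose metric
completion `T̄` is `Tb`) with a very small, minimal, isometric action of the free group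
`F(𝒜)` with dense orbits.  (For actions with dense orbits, "very small" is equivalent to
"trivial arc stabilizers".) -/
structure TreeSetup (ι : Type) where
  Tb : Type
  [ms : MetricSpace Tb]
  complete : CompleteSpace Tb
  tree : IsRTree Tb
  [act : MulAction (FreeGroup ι) Tb]
  act_isom : ∀ g : FreeGroup ι, Isometry fun x : Tb => g • x
  Tsub : Set Tb
  nonempty : Tsub.Nonempty
  dense : Dense Tsub
  sub_subtree : IsSubtree Tsub
  invariant : ∀ g : FreeGroup ι, ∀ x ∈ Tsub, g • x ∈ Tsub
  minimal : ∀ A : Set Tb, A ⊆ Tsub → A.Nonempty → IsSubtree A →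
      (∀ g : FreeGroup ι, ∀ x ∈ A, g • x ∈ A) → A = Tsub
  dense_orbits : ∀ x ∈ Tsub, Tsub ⊆ closure (Set.range fun g : FreeGroup ι => g • x)
  arc_stab : ∀ g : FreeGroup ι, ∀ x ∈ Tsub, ∀ y ∈ Tsub, x ≠ y →
      (fun p => g • p) '' seg x y = seg x y → g = 1

attribute [instance] TreeSetup.ms TreeSetup.act

/-- `𝒬(X) = Q` (for `Q ∈ T̄`), where `𝒬 : ∂F_N → T̂` is the map of Levitt–Lustig:
it is characterized by the property that whenever a sequence `uₙ ∈ F_N` converges to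
`X ∈ ∂F_N` and `uₙ P` converges metrically in `T̄` to a point `Q`, then `𝒬(X) = Q`. -/
def QRel {ι : Type} [DecidableEq ι] (St : TreeSetup ι) (X : InfWord ι) (Q : St.Tb) : Prop :=
  ∃ P ∈ St.Tsub, ∃ u : ℕ → FreeGroup ι, TendstoBoundary u X ∧
    Tendsto (fun n => u n • P) atTop (𝓝 Q)

/-- The limit set `Ω_𝒜 = 𝒬²(C²_𝒜 ∩ L²(T)) ⊆ T̄`: images of pairs of distinct boundary
points with distinct first letters (w.r.t. the basis `𝒜`) that are identified by `𝒬`. -/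
def limitSet {ι : Type} [DecidableEq ι] (St : TreeSetup ι) : Set St.Tb :=
  {Q | ∃ X Y : InfWord ι, X.letter 0 ≠ Y.letter 0 ∧ QRel St X Q ∧ QRel St Y Q}

/-- The heart `K_𝒜 ⊆ T̄`: the convex hull of the limit set `Ω_𝒜`. -/
def heart {ι : Type} [DecidableEq ι] (St : TreeSetup ι) : Set St.Tb :=
  subtreeHull (limitSet St)

/-- The dual algebraic lamination `L²(T) = {(X,Y) ∈ ∂²F_N : 𝒬(X) = 𝒬(Y)}`. -/
def L2 {ι : Type} [DecidableEq ι] (St : TreeSetup ι) : Set (InfWord ι × InfWord ι) :=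
  {p | p.1 ≠ p.2 ∧ ∃ Q : St.Tb, QRel St p.1 Q ∧ QRel St p.2 Q}

/-! ### The system of isometries induced on a compact subtree `K ⊆ T̄` -/

/-- The domain, inside `T̄`, of the partial isometry `x ↦ w⁻¹ x` of `K` induced by the word
`w`: the intersection of the translates of `K` by the prefixes of `w`. -/
def inducedDom {ι : Type} [DecidableEq ι] (St : TreeSetup ι) (K : Set St.Tb)
    (w : FreeGroup ι) : Set St.Tb :=
  ⋂ n ∈ Finset.range (w.toWord.length + 1), gprefix w n • K

/-- Admissibility of a word for the induced system of isometries `𝒦 = (K, 𝒜)`. -/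
def InducedAdmissible {ι : Type} [DecidableEq ι] (St : TreeSetup ι) (K : Set St.Tb)
    (w : FreeGroup ι) : Prop :=
  (inducedDom St K w).Nonempty

/-- The admissible laminary language `ℒ_adm(𝒦)` of the induced system `𝒦 = (K, 𝒜)`. -/
def inducedAdmLanguage {ι : Type} [DecidableEq ι] (St : TreeSetup ι) (K : Set St.Tb) :
    Set (FreeGroup ι) :=
  {w | ∀ k : ℕ, ∃ v : FreeGroup ι, InducedAdmissible St K v ∧
      ∃ p s : List (ι × Bool), p.length = k ∧ s.length = k ∧
        v.toWord = p ++ w.toWord ++ s}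

/-- Admissibility of an infinite word for the induced system `𝒦 = (K, 𝒜)`. -/
def InducedAdmissibleInf {ι : Type} [DecidableEq ι] (St : TreeSetup ι) (K : Set St.Tb)
    (X : InfWord ι) : Prop :=
  ∀ n, InducedAdmissible St K (X.prefixN n)

/-- The domain `dom(X) = ⋂ₙ dom(Xₙ)` of an infinite word, for the induced system. -/
def inducedDomInf {ι : Type} [DecidableEq ι] (St : TreeSetup ι) (K : Set St.Tb)
    (X : InfWord ι) : Set St.Tb :=
  ⋂ n, X.prefixN n • K

/-- Compatibility of a map `e : K → T'` with the system of partial isometries induced on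
`K ⊆ T̄` by the basis `𝒜`: this is condition (2) of Theorem 3.2 for the induced system. -/
def InducedCompat {ι : Type} (St : TreeSetup ι) (K : Set St.Tb) {T' : Type} [MetricSpace T']
    [MulAction (FreeGroup ι) T'] (e : K → T') : Prop :=
  ∀ (i : ι) (x : K) (h : (FreeGroup.of i)⁻¹ • (x : St.Tb) ∈ K),
    (FreeGroup.of i)⁻¹ • e x = e ⟨(FreeGroup.of i)⁻¹ • (x : St.Tb), h⟩

/-- The tree `T_𝒦` associated to the system of isometries induced on a compact subtree
`K ⊆ T̄`, presented through the characteristic properties of Theorem 3.2 (by which it is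
unique), together with the canonical `F(𝒜)`-equivariant morphism `j : T_𝒦 → T̄` restricting
to the identity on `K`. -/
structure InducedAssoc {ι : Type} (St : TreeSetup ι) (K : Set St.Tb) where
  TK : Type
  [ms : MetricSpace TK]
  tree : IsRTree TK
  [act : MulAction (FreeGroup ι) TK]
  act_isom : ∀ g : FreeGroup ι, Isometry fun x : TK => g • x
  emb : K → TK
  emb_isom : Isometry emb
  emb_subtree : IsSubtree (Set.range emb)
  compat : InducedCompat St K emb
  orbit_meets : ∀ p : TK, ∃ (w : FreeGroup ι) (x : K), p = w • emb x
  seg_cover : ∀ p q : TK, ∃ F : Finset (FreeGroup ι),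
      seg p q ⊆ ⋃ w ∈ F, w • Set.range emb
  universal : ∀ (T' : Type) [MetricSpace T'] [MulAction (FreeGroup ι) T'],
      (∀ g : FreeGroup ι, Isometry fun x : T' => g • x) →
      ∀ e' : K → T', Isometry e' → InducedCompat St K e' →
      ∃! f : TK → T', IsTreeMorphism f ∧
        (∀ (g : FreeGroup ι) (p : TK), f (g • p) = g • f p) ∧
        ∀ x : K, f (emb x) = e' x
  jmap : TK → St.Tb
  jmap_morphism : IsTreeMorphism jmap
  jmap_equivariant : ∀ (g : FreeGroup ι) (p : TK), jmap (g • p) = g • jmap p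
  jmap_emb : ∀ x : K, jmap (emb x) = (x : St.Tb)

attribute [instance] InducedAssoc.ms InducedAssoc.act

/-! ### Change of basis -/

/-- Changing the basis of the free group: the same tree, with the action precomposed with
the automorphism `φ` of `F(𝒜)`.  The heart of `St.twist φ` is the heart of `T` with respect
to the basis `φ(𝒜)`. -/
def TreeSetup.twist {ι : Type} (St : TreeSetup ι) (φ : FreeGroup ι ≃* FreeGroup ι) :
    TreeSetup ι where
  Tb := St.Tb
  ms := St.ms
  complete := St.complete
  tree := St.tree
  act := { smul := fun g x => φ g • x
           one_smul := fun x => by show φ 1 • x = x; rw [map_one, one_smul]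
           mul_smul := fun g h x => by
             show φ (g * h) • x = φ g • φ h • x
             rw [map_mul, mul_smul] }
  act_isom := fun g => St.act_isom (φ g)
  Tsub := St.Tsub
  nonempty := St.nonempty
  dense := St.dense
  sub_subtree := St.sub_subtree
  invariant := fun g x hx => St.invariant (φ g) x hx
  minimal := fun A hA hne hsub hinv => St.minimal A hA hne hsub (fun g x hx => by
    have h : φ (φ.symm g) • x ∈ A := hinv (φ.symm g) x hx
    rwa [MulEquiv.apply_symm_apply] at h)
  dense_orbits := fun x hx => by
    have hr : (Set.range fun g : FreeGroup ι => φ g • x) =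
        Set.range fun g : FreeGroup ι => g • x := by
      apply Set.ext; intro y
      constructor
      · rintro ⟨g, rfl⟩; exact ⟨φ g, rfl⟩
      · rintro ⟨g, rfl⟩; exact ⟨φ.symm g, by simp⟩
    show St.Tsub ⊆ closure (Set.range fun g : FreeGroup ι => φ g • x)
    rw [hr]; exact St.dense_orbits x hx
  arc_stab := fun g x hx y hy hxy him => by
    have h1 : φ g = 1 := St.arc_stab (φ g) x hx y hy hxy him
    have h2 := congrArg φ.symm h1
    simpa using h2

/-! ### The boundary `∂T`, the space `T̂ = T̄ ∪ ∂T` and the observers' topology -/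

/-- An isometric ray (parametrized on `[0,∞)`) in a metric space. -/
def IsRay {T : Type} [MetricSpace T] (r : ℝ → T) : Prop :=
  ∀ s t : ℝ, 0 ≤ s → 0 ≤ t → dist (r s) (r t) = |s - t|

/-- The type of isometric rays in `T`. -/
def Ray (T : Type) [MetricSpace T] : Type := {r : ℝ → T // IsRay r}

/-- Two rays define the same end iff they are at bounded distance. -/
def rayEnd (T : Type) [MetricSpace T] : Setoid (Ray T) where
  r := fun r₁ r₂ => ∃ C : ℝ, ∀ t : ℝ, 0 ≤ t → dist (r₁.1 t) (r₂.1 t) ≤ C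
  iseqv := by
    refine ⟨fun r => ⟨0, fun t _ => by simp⟩, ?_, ?_⟩
    · rintro r₁ r₂ ⟨C, hC⟩
      exact ⟨C, fun t ht => by rw [dist_comm]; exact hC t ht⟩
    · rintro r₁ r₂ r₃ ⟨C, hC⟩ ⟨D, hD⟩
      exact ⟨C + D, fun t ht =>
        (dist_triangle _ (r₂.1 t) _).trans (add_le_add (hC t ht) (hD t ht))⟩

/-- The Gromov boundary `∂T`: ends of `T`, i.e. classes of rays at bounded distance. -/
def GromovBoundary (T : Type) [MetricSpace T] : Type := Quotient (rayEnd T)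

/-- The space `T̂ = T̄ ∪ ∂T` (for `T` a complete ℝ-tree, representing the completion `T̄`). -/
def TreeHat (T : Type) [MetricSpace T] : Type := T ⊕ GromovBoundary T

/-- The segment `[x, ξ]` from a point `x ∈ T̄` to a boundary point `ξ ∈ ∂T`. -/
def raySeg {T : Type} [MetricSpace T] (x : T) (ξ : GromovBoundary T) : Set (TreeHat T) :=
  ({Sum.inr ξ} : Set (TreeHat T)) ∪ Sum.inl ''
    {p | ∃ r : Ray T, Quotient.mk (rayEnd T) r = ξ ∧ r.1 0 = x ∧ ∃ t : ℝ, 0 ≤ t ∧ r.1 t = p}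

/-- The segment `[ξ, η]` between two boundary points. -/
def lineSeg {T : Type} [MetricSpace T] (ξ η : GromovBoundary T) : Set (TreeHat T) :=
  ({Sum.inr ξ, Sum.inr η} : Set (TreeHat T)) ∪ Sum.inl ''
    {p | ∃ r r' : Ray T, Quotient.mk (rayEnd T) r = ξ ∧ Quotient.mk (rayEnd T) r' = η ∧
      r.1 0 = p ∧ r'.1 0 = p ∧ ∀ s t : ℝ, 0 ≤ s → 0 ≤ t → dist (r.1 s) (r'.1 t) = s + t}

/-- The segment `[P, Q]` between two points of `T̂ = T̄ ∪ ∂T`. -/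
def segHat {T : Type} [MetricSpace T] : TreeHat T → TreeHat T → Set (TreeHat T)
  | Sum.inl x, Sum.inl y => Sum.inl '' seg x y
  | Sum.inl x, Sum.inr ξ => raySeg x ξ
  | Sum.inr ξ, Sum.inl x => raySeg x ξ
  | Sum.inr ξ, Sum.inr η => lineSeg ξ η

/-- The observers' topology on `T̂`: generated by the set of directions, where the direction
at `P` containing `x` is the set of points `y` with `P ∉ [x,y]` (i.e. the connected component
of `T̂ ∖ {P}` containing `x`). -/
def observersTopology (T : Type) [MetricSpace T] : TopologicalSpace (TreeHat T) :=
  TopologicalSpace.generateFrom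
    {D | ∃ P x : TreeHat T, x ≠ P ∧ D = {y | y ≠ P ∧ P ∉ segHat x y}}

/-- The extension to `T̂ = T̄ ∪ ∂T` of an isometric action on `T̄`. -/
def TreeHat.smul {T : Type} [MetricSpace T] {G : Type} [Group G] [MulAction G T]
    (hiso : ∀ g : G, Isometry fun x : T => g • x) (g : G) : TreeHat T → TreeHat T
  | Sum.inl x => Sum.inl (g • x)
  | Sum.inr ξ => Sum.inr <| Quotient.map'
      (fun r : Ray T => (⟨fun t => g • r.1 t, fun s t hs ht => by
        have h := (hiso g).dist_eq (r.1 s) (r.1 t)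
        simpa using h.trans (r.2 s t hs ht)⟩ : Ray T))
      (fun r r' h => by
        obtain ⟨C, hC⟩ := h
        exact ⟨C, fun t ht => by
          have h' := (hiso g).dist_eq (r.1 t) (r'.1 t)
          simpa using h'.le.trans (hC t ht)⟩) ξ

/-! ### Laminations -/

/-- An algebraic lamination (as a set of pairs of boundary points) is closed by diagonal
leaves. -/
def ClosedByDiagonal {ι : Type} (L : Set (InfWord ι × InfWord ι)) : Prop :=
  ∀ X X' X'' : InfWord ι, (X, X') ∈ L → (X', X'') ∈ L → X = X'' ∨ (X, X'') ∈ L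

/-- Invariance of a lamination under the `F(𝒜)`-action on `∂²F(𝒜)`. -/
def InvariantLam {ι : Type} [DecidableEq ι] (L : Set (InfWord ι × InfWord ι)) : Prop :=
  ∀ (w : FreeGroup ι) (X X' Y Y' : InfWord ι), (X, X') ∈ L →
    SmulBoundary w X Y → SmulBoundary w X' Y' → (Y, Y') ∈ L

/-- Invariance of a lamination under the flip map. -/
def FlipInvariant {ι : Type} (L : Set (InfWord ι × InfWord ι)) : Prop :=
  ∀ X Y : InfWord ι, (X, Y) ∈ L → (Y, X) ∈ L

/-- The dual lamination `L²(T)` is minimal up to diagonal leaves: it contains no proper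
non-trivial sublamination that is closed by diagonal leaves. -/
def MinimalUpToDiagonal {ι : Type} [DecidableEq ι] (St : TreeSetup ι) : Prop :=
  ∀ L : Set (InfWord ι × InfWord ι), L ⊆ L2 St → L.Nonempty → IsClosed L →
    InvariantLam L → FlipInvariant L → ClosedByDiagonal L → L = L2 St

end CHL

namespace CHL

/-! ### Segments in ℝ-trees -/

section Tree

variable {T : Type*} [MetricSpace T]

theorem mem_seg {x y z : T} : z ∈ seg x y ↔ dist x z + dist z y = dist x y := Iff.rfl

theorem mem_seg_of_le {x y z : T} (h : dist x z + dist z y ≤ dist x y) : z ∈ seg x y :=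
  le_antisymm h (dist_triangle _ _ _)

theorem seg_comm (x y : T) : seg x y = seg y x := by
  ext z
  rw [mem_seg, mem_seg, dist_comm x z, dist_comm z y, dist_comm x y, add_comm]

theorem seg_self (x : T) : seg x x = {x} := by
  ext z
  rw [mem_seg, dist_self, mem_singleton_iff, dist_comm z x]
  constructor
  · intro h
    exact (dist_eq_zero.1 (by linarith [dist_nonneg (x := x) (y := z)])).symm
  · rintro rfl; simp

theorem smul_mem_seg {G : Type*} [Group G] [MulAction G T] [IsIsometricSMul G T] (g : G)
    {x y z : T} : g • z ∈ seg (g • x) (g • y) ↔ z ∈ seg x y := by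
  simp [mem_seg]

theorem isSubtree_inter {A B : Set T} (hA : IsSubtree A) (hB : IsSubtree B) : IsSubtree (A ∩ B) :=
  fun x hx y hy _ hz => ⟨hA x hx.1 y hy.1 hz, hB x hx.2 y hy.2 hz⟩

/-- Continuous induction along a path `γ`: a closed set of parameters which contains `0` and
is stable under small steps to the right contains the last parameter. -/
theorem forall_geodesic_of_local {x y : T} {γ : ℝ → T}
    (hcont : ContinuousOn γ (Icc 0 (dist x y))) (hmem : ∀ t ∈ Icc 0 (dist x y), γ t ∈ seg x y)
    {S : Set ℝ} (hS : IsClosed (S ∩ Icc 0 (dist x y))) (hS0 : 0 ∈ S) {p : T → T → Prop}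
    (h : ∀ c ∈ seg x y, ∀ᶠ c' in 𝓝[seg x y] c, p c c')
    (hstep : ∀ t ∈ S, ∀ s, 0 ≤ t → t < s → s ≤ dist x y → p (γ t) (γ s) → s ∈ S) :
    dist x y ∈ S := by
  set D := dist x y with hD
  refine hS.Icc_subset_of_forall_exists_gt hS0 ?_ (right_mem_Icc.2 dist_nonneg)
  rintro t ⟨ht, ht0, htD⟩ u hu
  have h2 : Tendsto γ (𝓝[Ioc t D] t) (𝓝[seg x y] (γ t)) := by
    refine tendsto_nhdsWithin_iff.2 ⟨?_, ?_⟩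
    · exact (hcont t ⟨ht0, htD.le⟩).tendsto.mono_left (nhdsWithin_mono _ fun s hs =>
        ⟨ht0.trans hs.1.le, hs.2⟩)
    · filter_upwards [self_mem_nhdsWithin] with s hs
      exact hmem s ⟨ht0.trans hs.1.le, hs.2⟩
  have h3 := h2.eventually (h _ (hmem t ⟨ht0, htD.le⟩))
  have h4 : ∀ᶠ s in 𝓝[Ioc t D] t, s ≤ u := nhdsWithin_le_nhds (Iic_mem_nhds hu)
  have : (𝓝[Ioc t D] t).NeBot := by
    rw [nhdsWithin_Ioc_eq_nhdsGT htD]; infer_instance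
  obtain ⟨s, h5, h6, hs⟩ := (h3.and (h4.and self_mem_nhdsWithin)).exists
  exact ⟨s, hstep t ht s ht0 hs.1 hs.2 h5, hs.1, h6⟩

variable [IsRTree T]

theorem four_point_le {x y z w : T} {M : ℝ} (h₁ : dist x z + dist y w ≤ M)
    (h₂ : dist x w + dist y z ≤ M) : dist x y + dist z w ≤ M :=
  (IsRTree.four_point x y z w).trans (max_le h₁ h₂)

theorem exists_mem_seg {x y : T} {t : ℝ} (h₀ : 0 ≤ t) (h₁ : t ≤ dist x y) :
    ∃ z ∈ seg x y, dist x z = t := by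
  obtain ⟨f, h0, h1, hf⟩ := IsRTree.geodesic x y
  have ha := hf 0 ⟨le_rfl, dist_nonneg⟩ t ⟨h₀, h₁⟩
  have hb := hf t ⟨h₀, h₁⟩ (dist x y) ⟨dist_nonneg, le_rfl⟩
  rw [h0, zero_sub, abs_neg, abs_of_nonneg h₀] at ha
  rw [h1, abs_of_nonpos (by linarith)] at hb
  exact ⟨f t, by rw [mem_seg, ha, hb]; ring, ha⟩

theorem seg_dist {x y a b : T} (ha : a ∈ seg x y) (hb : b ∈ seg x y) :
    dist a b = |dist x a - dist x b| := by
  refine le_antisymm ?_ ?_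
  · rw [mem_seg] at ha hb
    have h : dist a b + dist x y ≤ max (dist x a + dist b y) (dist x b + dist a y) := by
      rcases le_max_iff.1 (IsRTree.four_point a b x y) with h | h
      · exact le_max_of_le_left (by rw [dist_comm a x] at h; exact h)
      · exact le_max_of_le_right (by rw [dist_comm b x] at h; linarith)
    rcases le_max_iff.1 h with h | h
    · exact (le_abs_self _).trans' (by linarith)
    · rw [abs_sub_comm]; exact (le_abs_self _).trans' (by linarith)
  · rw [dist_comm x a, dist_comm x b]; exact abs_dist_sub_le a b x

theorem seg_unique {x y a b : T} (ha : a ∈ seg x y) (hb : b ∈ seg x y)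
    (h : dist x a = dist x b) : a = b :=
  dist_eq_zero.1 (by rw [seg_dist ha hb, h, sub_self, abs_zero])

theorem mem_seg_or {x y : T} (z : T) {r : T} (hr : r ∈ seg x y) : r ∈ seg x z ∨ r ∈ seg z y := by
  rw [mem_seg] at hr
  rcases le_max_iff.1 (IsRTree.four_point x y r z) with h | h
  · right; refine mem_seg_of_le ?_
    rw [dist_comm y z] at h; rw [dist_comm z r]; linarith
  · left; refine mem_seg_of_le ?_
    rw [dist_comm y r] at h; linarith

/-- Two segments issued from `y` coincide up to their branching point. -/
theorem fork {x y z a b : T} (ha : a ∈ seg y x) (hb : b ∈ seg y z) (h : dist y a = dist y b)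
    (hs : 2 * dist y a ≤ dist y x + dist y z - dist x z) : a = b := by
  have haz : a ∈ seg y z := by
    rw [mem_seg] at *
    refine mem_seg_of_le ?_
    have : dist a z + dist y x ≤ dist y x + dist y z - dist y a := by
      refine four_point_le ?_ ?_
      · rw [dist_comm a y, dist_comm z x]; linarith
      · rw [dist_comm z y]; linarith
    linarith
  exact seg_unique haz hb h

/-- A chain of points with constant steps that is geodesic on consecutive triples is geodesic. -/
theorem dist_chain {x : ℕ → T} {τ : ℝ} (hτ : 0 < τ) (h1 : ∀ i, dist (x i) (x (i + 1)) = τ)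
    (h2 : ∀ i, dist (x i) (x (i + 2)) = 2 * τ) (n : ℕ) : dist (x 0) (x n) = n * τ := by
  suffices h : ∀ n, dist (x 0) (x n) = n * τ ∧ dist (x 0) (x (n + 1)) = (n + 1 : ℕ) * τ from (h n).1
  intro n
  induction n with
  | zero => simp [h1]
  | succ n ih =>
    refine ⟨ih.2, ?_⟩
    have hu : dist (x 0) (x (n + 2)) ≤ (n + 2 : ℕ) * τ := by
      have := dist_triangle (x 0) (x (n + 1)) (x (n + 2))
      rw [ih.2, h1] at this; push_cast at this ⊢; linarith
    refine le_antisymm hu ?_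
    have h4 := IsRTree.four_point (x 0) (x (n + 1)) (x n) (x (n + 2))
    rw [ih.2, h2, ih.1, h1 (n + 1), dist_comm (x (n + 1)), h1 n] at h4
    push_cast at h4 ⊢
    rcases le_max_iff.1 h4 with h | h <;> linarith

/-- Two points are joined by a path parametrized by arc length. -/
theorem exists_geodesic (x y : T) : ∃ γ : ℝ → T, γ 0 = x ∧ γ (dist x y) = y ∧
    ContinuousOn γ (Icc 0 (dist x y)) ∧ (∀ t ∈ Icc 0 (dist x y), γ t ∈ seg x y) ∧
    ∀ s ∈ Icc 0 (dist x y), ∀ t ∈ Icc 0 (dist x y), dist (γ s) (γ t) = |s - t| := by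
  obtain ⟨γ, h0, h1, hγ⟩ := IsRTree.geodesic x y
  have hl : (0 : ℝ) ∈ Icc 0 (dist x y) := ⟨le_rfl, dist_nonneg⟩
  have hr : dist x y ∈ Icc 0 (dist x y) := ⟨dist_nonneg, le_rfl⟩
  refine ⟨γ, h0, h1, ?_, fun t ht => ?_, hγ⟩
  · refine LipschitzOnWith.continuousOn (K := 1)
      (LipschitzOnWith.of_dist_le_mul fun s hs t ht => ?_)
    rw [hγ s hs t ht, Real.dist_eq]; simp
  · have e1 := hγ 0 hl t ht
    have e2 := hγ t ht _ hr
    rw [h0, zero_sub, abs_neg, abs_of_nonneg ht.1] at e1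
    rw [h1, abs_of_nonpos (by linarith [ht.2])] at e2
    rw [mem_seg, e1, e2]; ring

theorem isPreconnected_of_isSubtree {A : Set T} (hA : IsSubtree A) : IsPreconnected A := by
  refine isPreconnected_of_forall_pair fun x hx y hy => ?_
  obtain ⟨γ, h0, h1, hcont, hmem, -⟩ := exists_geodesic x y
  refine ⟨γ '' Icc 0 (dist x y), ?_, ⟨0, ⟨le_rfl, dist_nonneg⟩, h0⟩,
    ⟨_, ⟨dist_nonneg, le_rfl⟩, h1⟩, isPreconnected_Icc.image _ hcont⟩
  rintro _ ⟨t, ht, rfl⟩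
  exact hA x hx y hy (hmem t ht)

/-- A `1`-Lipschitz map between ℝ-trees that is injective on a segment and locally isometric at each
point of it preserves the distance between the endpoints. -/
theorem dist_eq_of_local {T' : Type*} [MetricSpace T'] [IsRTree T'] {f : T → T'}
    (hf : ∀ p q, dist (f p) (f q) ≤ dist p q) {x y : T} (hinj : InjOn f (seg x y))
    (h : ∀ c ∈ seg x y, ∀ᶠ c' in 𝓝[seg x y] c, dist (f c) (f c') = dist c c') :
    dist (f x) (f y) = dist x y := by
  obtain ⟨γ, h0, h1, hcont, hmem, hγ⟩ := exists_geodesic x y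
  have hfc : Continuous f := (LipschitzWith.of_dist_le_mul (K := 1) (by simpa using hf)).continuous
  set D := dist x y with hD
  have key := forall_geodesic_of_local hcont hmem (S := {t | dist (f x) (f (γ t)) = t}) ?_ ?_ h ?_
  · rw [← hD] at key
    have key : dist (f x) (f (γ D)) = D := key
    rwa [h1] at key
  · have hc : ContinuousOn (fun t => dist (f x) (f (γ t))) (Icc 0 D) :=
      (continuous_const.dist hfc).comp_continuousOn hcont
    have := (hc.sub continuousOn_id).preimage_isClosed_of_isClosed isClosed_Icc
      (isClosed_singleton (x := (0 : ℝ)))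
    convert this using 1
    ext t
    simp [and_comm, sub_eq_zero, hD]
  · simp [h0]
  · intro t ht s ht0 hts hsD hloc
    have ht : dist (f x) (f (γ t)) = t := ht
    show dist (f x) (f (γ s)) = s
    have hd : ∀ a b, 0 ≤ a → a ≤ b → b ≤ D → dist (γ a) (γ b) = b - a := fun a b h₁ h₂ h₃ => by
      rw [hγ a ⟨h₁, h₂.trans h₃⟩ b ⟨h₁.trans h₂, h₃⟩, abs_of_nonpos (by linarith)]; ring
    rw [hd t s ht0 hts.le hsD] at hloc
    have hx : ∀ a, 0 ≤ a → a ≤ D → dist (f x) (f (γ a)) ≤ a := fun a h₁ h₂ => by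
      have := hd 0 a le_rfl h₁ h₂
      rw [h0, sub_zero] at this
      exact (hf _ _).trans this.le
    refine le_antisymm (hx s (ht0.trans hts.le) hsD) ?_
    by_contra! hlt
    set η := (s - dist (f x) (f (γ s))) / 2 with hη
    have hη0 : 0 < η := by rw [hη]; linarith
    have hηt : η ≤ t := by
      have := dist_triangle_left (f (γ t)) (f (γ s)) (f x)
      have := dist_triangle (f (γ t)) (f x) (f (γ s))
      rw [dist_comm _ (f x), ht, hloc] at this
      rw [hη]; linarith
    have hηs : η ≤ s - t := by
      have := dist_triangle (f x) (f (γ s)) (f (γ t))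
      rw [ht, dist_comm (f (γ s)), hloc] at this
      rw [hη]; linarith
    have ea : dist (f (γ t)) (f (γ (t - η))) ≤ η := by
      rw [dist_comm]
      exact (hf _ _).trans (by rw [hd _ _ (by linarith) (by linarith) (by linarith)]; linarith)
    have eb : dist (f (γ t)) (f (γ (t + η))) ≤ η :=
      (hf _ _).trans (by rw [hd _ _ (by linarith) (by linarith) (by linarith)]; linarith)
    have ea' := hx (t - η) (by linarith) (by linarith)
    have eb' : dist (f (γ (t + η))) (f (γ s)) ≤ s - t - η :=
      (hf _ _).trans (by rw [hd _ _ (by linarith) (by linarith) (by linarith)]; linarith)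
    have ta := dist_triangle (f x) (f (γ (t - η))) (f (γ t))
    have tb := dist_triangle (f (γ t)) (f (γ (t + η))) (f (γ s))
    rw [ht, dist_comm (f (γ (t - η)))] at ta
    rw [hloc] at tb
    have hab : f (γ (t - η)) = f (γ (t + η)) := by
      refine fork (y := f (γ t)) (x := f x) (z := f (γ s)) (mem_seg_of_le ?_) (mem_seg_of_le ?_) ?_ ?_
      · rw [dist_comm _ (f x), dist_comm _ (f x), ht]; linarith
      · rw [hloc]; linarith
      · linarith
      · rw [dist_comm _ (f x), ht, hloc]; linarith
    have := hinj (hmem _ ⟨by linarith, by linarith⟩) (hmem _ ⟨by linarith, by linarith⟩) hab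
    have h2 := hd (t - η) (t + η) (by linarith) (by linarith) (by linarith)
    rw [this, dist_self] at h2
    linarith

end Tree

/-! ### Reduced words and infinite words -/

section Words

open FreeGroup

variable {ι : Type*}

theorem not_lettersInv_iff {a b : ι × Bool} : ¬ LettersInv a b ↔ (a.1 = b.1 → a.2 = b.2) := by
  unfold LettersInv
  cases a.2 <;> cases b.2 <;> simp

theorem not_lettersInv_comm {a b : ι × Bool} : ¬ LettersInv a b ↔ ¬ LettersInv b a := by
  rw [not_lettersInv_iff, not_lettersInv_iff, eq_comm, @eq_comm _ a.2]

/-- The inverse letter. -/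
def linv (a : ι × Bool) : ι × Bool := (a.1, !a.2)

@[simp] theorem linv_linv (a : ι × Bool) : linv (linv a) = a := by simp [linv]

theorem lettersInv_iff {a b : ι × Bool} : LettersInv a b ↔ b = linv a := by
  unfold LettersInv linv
  constructor
  · rintro ⟨h₁, h₂⟩; ext <;> simp [h₁, h₂]
  · rintro rfl; simp

theorem isReduced_append {L₁ L₂ : List (ι × Bool)} (h₁ : IsReduced L₁) (h₂ : IsReduced L₂)
    (h : ∀ a ∈ L₁.getLast?, ∀ b ∈ L₂.head?, ¬ LettersInv a b) : IsReduced (L₁ ++ L₂) :=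
  List.isChain_append.2 ⟨h₁, h₂, fun a ha b hb => not_lettersInv_iff.1 (h a ha b hb)⟩

theorem mk_cons (a : ι × Bool) (L : List (ι × Bool)) : mk (a :: L) = mk [a] * mk L := by
  exact (mul_mk (L₁ := [a]) (L₂ := L)).symm

theorem mk_append (L₁ L₂ : List (ι × Bool)) : mk (L₁ ++ L₂) = mk L₁ * mk L₂ := mul_mk.symm

theorem mk_linv (a : ι × Bool) : mk [linv a] = (mk [a])⁻¹ := by
  rw [inv_mk]; rfl

theorem exists_cancel_list (L₁ L₂ : List (ι × Bool)) (h₁ : IsReduced L₁) (h₂ : IsReduced L₂) :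
    ∃ p c q, L₁ = p ++ c ∧ L₂ = invRev c ++ q ∧ IsReduced (p ++ q) := by
  induction L₁ using List.reverseRecOn generalizing L₂ with
  | nil => exact ⟨[], [], L₂, by simp, by simp, by simpa using h₂⟩
  | append_singleton L a ih =>
    rcases L₂ with _ | ⟨b, L₂⟩
    · exact ⟨L ++ [a], [], [], by simp, by simp, by simpa using h₁⟩
    by_cases hab : LettersInv a b
    · obtain ⟨p, c, q, rfl, rfl, h⟩ := ih L₂ (h₁.infix ⟨[], [a], by simp⟩)
        (h₂.infix ⟨[b], [], by simp⟩)
      refine ⟨p, c ++ [a], q, by simp, ?_, h⟩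
      rw [lettersInv_iff] at hab
      subst hab
      simp [invRev, linv]
    · refine ⟨L ++ [a], [], b :: L₂, by simp, by simp, isReduced_append h₁ h₂ ?_⟩
      simpa using hab

variable [DecidableEq ι]

theorem toWord_mk_of_isReduced {L : List (ι × Bool)} (h : IsReduced L) : (mk L).toWord = L := by
  rw [toWord_mk, h.reduce_eq]

theorem toWord_mul_of_isReduced {x y : FreeGroup ι} (h : IsReduced (x.toWord ++ y.toWord)) :
    (x * y).toWord = x.toWord ++ y.toWord := by
  rw [toWord_mul, h.reduce_eq]

theorem exists_cancel (x y : FreeGroup ι) :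
    ∃ p c q, x.toWord = p ++ c ∧ y.toWord = invRev c ++ q ∧ (x * y).toWord = p ++ q := by
  obtain ⟨p, c, q, h₁, h₂, h₃⟩ := exists_cancel_list _ _ (isReduced_toWord (x := x))
    (isReduced_toWord (x := y))
  refine ⟨p, c, q, h₁, h₂, ?_⟩
  rw [← toWord_mk_of_isReduced h₃]
  congr 1
  rw [← mk_toWord (x := x), ← mk_toWord (x := y), h₁, h₂, mk_append, mk_append, mk_append,
    ← inv_mk]
  group

theorem toWord_inv_mul {x y : FreeGroup ι} (h : ∀ a ∈ x.toWord.head?, a ∉ y.toWord.head?) :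
    (x⁻¹ * y).toWord = invRev x.toWord ++ y.toWord := by
  obtain ⟨p, c, q, h₁, h₂, h₃⟩ := exists_cancel x⁻¹ y
  rw [toWord_inv] at h₁
  have hx : x.toWord = invRev c ++ invRev p := by rw [← invRev_append, ← h₁, invRev_invRev]
  rcases hc : invRev c with _ | ⟨a, l⟩
  · have : c = [] := by rw [← invRev_invRev (L₁ := c), hc]; rfl
    subst this
    rw [h₃, h₁, h₂]; simp
  · refine absurd ?_ (h a ?_)
    · rw [h₂, hc]; simp
    · rw [hx, hc]; simp

theorem take_toWord_mul {u g : FreeGroup ι} {k : ℕ} (h : k + g.toWord.length ≤ u.toWord.length) :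
    (u * g).toWord.take k = u.toWord.take k := by
  obtain ⟨p, c, q, h₁, h₂, h₃⟩ := exists_cancel u g
  rw [h₁, h₂] at h
  simp only [List.length_append, invRev_length] at h
  rw [h₁, h₃, List.take_append_of_le_length (by omega), List.take_append_of_le_length (by omega)]

theorem isReduced_of_append_right {g : FreeGroup ι} {L₁ L₂ : List (ι × Bool)}
    (h : g.toWord = L₁ ++ L₂) : IsReduced L₂ :=
  (isReduced_toWord (x := g)).infix ⟨L₁, [], by simp [h]⟩

theorem eq_mk_mul_mk {g : FreeGroup ι} {L₁ L₂ : List (ι × Bool)}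
    (h : g.toWord = L₁ ++ L₂) : g = mk L₁ * mk L₂ := by
  rw [← mk_append, ← h, mk_toWord]

theorem toWord_mk_drop (g : FreeGroup ι) (k : ℕ) :
    (mk (g.toWord.drop k)).toWord = g.toWord.drop k :=
  toWord_mk_of_isReduced (isReduced_of_append_right (List.take_append_drop k _).symm)

theorem mk_take_mul_mk_drop (g : FreeGroup ι) (k : ℕ) :
    mk (g.toWord.take k) * mk (g.toWord.drop k) = g := by
  rw [← mk_append, List.take_append_drop, mk_toWord]

theorem mul_mk_take {s β : FreeGroup ι} {L : ℕ} (hs : s.toWord.length ≤ L)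
    (h : (s * β).toWord.take (4 * L) = β.toWord.take (4 * L)) :
    ∃ a ≤ L, ∃ b ≤ L, ∀ t, L ≤ t → t ≤ 3 * L →
      s * mk (β.toWord.take t) = mk (β.toWord.take (t + a - b)) := by
  obtain ⟨p, c, q, h₁, h₂, h₃⟩ := exists_cancel s β
  have hl : p.length + c.length ≤ L := by rw [h₁] at hs; simpa using hs
  refine ⟨p.length, by omega, c.length, by omega, fun t h₄ h₅ => ?_⟩
  have e₁ : β.toWord.take t = invRev c ++ q.take (t - c.length) := by
    rw [h₂, List.take_append, List.take_of_length_le (by simp; omega), invRev_length]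
  have e₂ : β.toWord.take (t + p.length - c.length) = p ++ q.take (t - c.length) := by
    have : (s * β).toWord.take (t + p.length - c.length) =
        β.toWord.take (t + p.length - c.length) := by
      have := congrArg (List.take (t + p.length - c.length)) h
      rwa [List.take_take, List.take_take, min_eq_left (by omega)] at this
    rw [← this, h₃, List.take_append, List.take_of_length_le (by omega)]
    congr 2; omega
  rw [e₁, e₂, mk_append, mk_append, ← inv_mk, ← mul_assoc]
  congr 1
  nth_rw 1 [← mk_toWord (x := s)]
  rw [h₁, mk_append, mul_inv_cancel_right]

/-- Two non-commuting elements cannot both preserve a long prefix of a word. -/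
theorem exists_short_common_prefix {s₁ s₂ : FreeGroup ι} (hne : s₁ * s₂ ≠ s₂ * s₁) {L : ℕ}
    (h₁ : s₁.toWord.length ≤ L) (h₂ : s₂.toWord.length ≤ L) (α β : FreeGroup ι) :
    ∃ s, (s = 1 ∨ s = s₁ ∨ s = s₂) ∧
      α.toWord.take (4 * L) ≠ (s * β).toWord.take (4 * L) := by
  by_contra! h
  have h0 := h 1 (Or.inl rfl)
  rw [one_mul] at h0
  obtain ⟨a₁, ha₁, b₁, hb₁, e₁⟩ := mul_mk_take h₁ ((h s₁ (by simp)).symm.trans h0)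
  obtain ⟨a₂, ha₂, b₂, hb₂, e₂⟩ := mul_mk_take h₂ ((h s₂ (by simp)).symm.trans h0)
  apply hne
  apply mul_right_cancel (b := mk (β.toWord.take (2 * L)))
  rw [mul_assoc, mul_assoc, e₂ _ (by omega) (by omega), e₁ _ (by omega) (by omega),
    e₁ _ (by omega) (by omega), e₂ _ (by omega) (by omega)]
  congr 2; omega

namespace InfWord

variable (X Y : InfWord ι)

omit [DecidableEq ι] in
theorem isReduced_ofFn (n : ℕ) : FreeGroup.IsReduced (List.ofFn fun i : Fin n => X.letter i) := by
  rw [FreeGroup.IsReduced, List.isChain_iff_getElem]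
  intro i hi
  simp only [List.getElem_ofFn]
  exact not_lettersInv_iff.1 (X.reduced i)

theorem toWord_prefixN (n : ℕ) :
    (X.prefixN n).toWord = List.ofFn fun i : Fin n => X.letter i :=
  toWord_mk_of_isReduced (X.isReduced_ofFn n)

@[simp] theorem length_prefixN (n : ℕ) : (X.prefixN n).toWord.length = n := by
  rw [toWord_prefixN, List.length_ofFn]

theorem take_toWord_prefixN {n m : ℕ} (h : m ≤ n) :
    (X.prefixN n).toWord.take m = (X.prefixN m).toWord := by
  rw [toWord_prefixN, toWord_prefixN]
  refine List.ext_getElem (by simpa using h) fun i h₁ h₂ => ?_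
  simp

omit [DecidableEq ι] in
@[simp] theorem prefixN_zero : X.prefixN 0 = 1 := rfl

omit [DecidableEq ι] in
theorem prefixN_add (k n : ℕ) : X.prefixN (k + n) = X.prefixN k * (X.shift k).prefixN n := by
  unfold prefixN
  rw [← mk_append]
  congr 1
  refine List.ext_getElem (by simp) fun i h₁ h₂ => ?_
  simp only [List.getElem_ofFn, List.getElem_append, List.length_ofFn]
  split_ifs with h
  · rfl
  · simp only [shift]; congr 1; omega

omit [DecidableEq ι] in
theorem prefixN_one : X.prefixN 1 = FreeGroup.mk [X.letter 0] := rfl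

omit [DecidableEq ι] in
theorem prefixN_succ (n : ℕ) : X.prefixN (n + 1) = X.prefixN n * FreeGroup.mk [X.letter n] :=
  X.prefixN_add n 1

omit [DecidableEq ι] in
variable {X Y} in
theorem ext_letter (h : ∀ n, X.letter n = Y.letter n) : X = Y := by
  cases X; cases Y; congr; exact funext h

omit [DecidableEq ι] in
variable {X Y} in
theorem exists_first_ne (h : X ≠ Y) :
    ∃ k, X.prefixN k = Y.prefixN k ∧ (X.shift k).letter 0 ≠ (Y.shift k).letter 0 := by
  classical
  have : ∃ n, X.letter n ≠ Y.letter n := by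
    by_contra! h'; exact h (ext_letter h')
  refine ⟨Nat.find this, ?_, by simpa [shift] using Nat.find_spec this⟩
  unfold prefixN
  congr 2
  funext i
  exact not_not.1 (Nat.find_min this i.2)

/-- The infinite word obtained by adding a first letter. -/
def cons (a : ι × Bool) (X : InfWord ι) (h : ¬ LettersInv a (X.letter 0)) : InfWord ι where
  letter n := match n with
    | 0 => a
    | n + 1 => X.letter n
  reduced n := match n with
    | 0 => h
    | n + 1 => X.reduced n

omit [DecidableEq ι] in
theorem prefixN_cons (a : ι × Bool) (h : ¬ LettersInv a (X.letter 0)) (n : ℕ) :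
    (X.cons a h).prefixN (n + 1) = FreeGroup.mk [a] * X.prefixN n := by
  rw [add_comm, prefixN_add, prefixN_one]
  congr 1
  show FreeGroup.mk _ = FreeGroup.mk _
  congr 2
  funext i
  simp only [shift, add_comm 1]
  rfl

end InfWord

theorem tendstoBoundary_iff {u : ℕ → FreeGroup ι} {X : InfWord ι} :
    TendstoBoundary u X ↔
      ∀ k, ∀ᶠ n in atTop, (u n).toWord.take k = (X.prefixN k).toWord := by
  simp only [TendstoBoundary, X.toWord_prefixN]

theorem TendstoBoundary.length_ge {u : ℕ → FreeGroup ι} {X : InfWord ι}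
    (h : TendstoBoundary u X) (k : ℕ) : ∀ᶠ n in atTop, k ≤ (u n).toWord.length := by
  filter_upwards [tendstoBoundary_iff.1 h k] with n hn
  have := congrArg List.length hn
  rw [List.length_take, InfWord.length_prefixN] at this
  omega

theorem TendstoBoundary.mul_right {u : ℕ → FreeGroup ι} {X : InfWord ι}
    (h : TendstoBoundary u X) (g : FreeGroup ι) : TendstoBoundary (fun n => u n * g) X := by
  intro k
  filter_upwards [h k, h.length_ge (k + g.toWord.length)] with n h₁ h₂
  rw [take_toWord_mul h₂, h₁]

theorem eq_prefixN_mul {g : FreeGroup ι} {X : InfWord ι} {k : ℕ}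
    (h : g.toWord.take k = (X.prefixN k).toWord) :
    g = X.prefixN k * mk (g.toWord.drop k) := by
  rw [← mk_toWord (x := X.prefixN k), ← h, mk_take_mul_mk_drop]

theorem TendstoBoundary.shift {u : ℕ → FreeGroup ι} {X : InfWord ι}
    (h : TendstoBoundary u X) (k : ℕ) :
    TendstoBoundary (fun n => (X.prefixN k)⁻¹ * u n) (X.shift k) := by
  rw [tendstoBoundary_iff] at *
  intro m
  filter_upwards [h k, h (k + m)] with n h₁ h₂
  have e := eq_prefixN_mul h₁
  rw [inv_mul_eq_of_eq_mul e, toWord_mk_drop, List.take_drop, h₂, InfWord.toWord_prefixN,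
    InfWord.toWord_prefixN]
  refine List.ext_getElem (by simp) fun i _ _ => ?_
  simp [InfWord.shift]

theorem TendstoBoundary.cons {u : ℕ → FreeGroup ι} {X : InfWord ι}
    (h : TendstoBoundary u X) (a : ι × Bool) (ha : ¬ LettersInv a (X.letter 0)) :
    TendstoBoundary (fun n => mk [a] * u n) (X.cons a ha) := by
  rw [tendstoBoundary_iff] at *
  intro m
  filter_upwards [h 1, h m] with n h₁ h₂
  have hw : (mk [a] * u n).toWord = a :: (u n).toWord := by
    rw [toWord_mul_of_isReduced, toWord_mk_of_isReduced IsReduced.singleton]; · rfl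
    rw [toWord_mk_of_isReduced IsReduced.singleton]
    refine isReduced_append IsReduced.singleton isReduced_toWord fun b hb c hc => ?_
    have : (u n).toWord.head? = some (X.letter 0) := by
      have := congrArg List.head? h₁
      rwa [List.head?_take, if_neg one_ne_zero, X.toWord_prefixN] at this
    rw [this] at hc
    simp only [List.getLast?_singleton, Option.mem_def, Option.some.injEq] at hb hc
    rw [← hb, ← hc]; exact ha
  rcases m with _ | m
  · simp
  rw [hw, List.take_succ_cons, X.prefixN_cons, toWord_mul_of_isReduced,
    toWord_mk_of_isReduced IsReduced.singleton]
  · have := congrArg (List.take m) h₂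
    rw [List.take_take, X.take_toWord_prefixN (by omega), min_eq_left (by omega)] at this
    rw [this]; rfl
  · rw [toWord_mk_of_isReduced IsReduced.singleton]
    refine isReduced_append IsReduced.singleton isReduced_toWord fun b hb c hc => ?_
    rw [X.toWord_prefixN] at hc
    rcases m with _ | m
    · simp at hc
    · simp only [List.ofFn_succ, List.head?_cons, List.getLast?_singleton, Option.mem_def,
        Option.some.injEq] at hb hc
      rw [← hb, ← hc]; exact ha

end Words

section Commuting

open FreeGroup (of toWord)

/-- Pairwise commuting elements of a free group are powers of a common element. -/
theorem exists_zpow_of_commute {ι : Type*} (s : Set (FreeGroup ι))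
    (h : ∀ a ∈ s, ∀ b ∈ s, a * b = b * a) : ∃ k, ∀ g ∈ s, ∃ n : ℤ, g = k ^ n := by
  let H := Subgroup.closure s
  have : IsMulCommutative H := Subgroup.isMulCommutative_closure h
  let φ := IsFreeGroup.toFreeGroup H
  have hc : ∀ x y : FreeGroup (IsFreeGroup.Generators H), x * y = y * x := fun x y => by
    apply φ.symm.injective
    rw [map_mul, map_mul]
    exact mul_comm' (φ.symm x) (φ.symm y)
  have hsub : Subsingleton (IsFreeGroup.Generators H) := ⟨fun a b => by
    classical
    by_contra hab
    have := congrArg toWord (hc (of a) (of b))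
    rw [toWord_mul_of_isReduced, toWord_mul_of_isReduced] at this
    · simp [hab] at this
    all_goals simp [FreeGroup.IsReduced]⟩
  have key : ∃ k, ∀ x : FreeGroup (IsFreeGroup.Generators H), ∃ n : ℤ, x = k ^ n := by
    rcases isEmpty_or_nonempty (IsFreeGroup.Generators H) with he | ⟨⟨a⟩⟩
    · exact ⟨1, fun x => ⟨0, Subsingleton.elim _ _⟩⟩
    · refine ⟨of a, fun x => ?_⟩
      induction x using FreeGroup.induction_on with
      | C1 => exact ⟨0, by simp⟩
      | of b => exact ⟨1, by rw [Subsingleton.elim b a, zpow_one]⟩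
      | inv_of b _ => exact ⟨-1, by rw [Subsingleton.elim b a, zpow_neg_one]⟩
      | mul x y hx hy =>
        obtain ⟨m, rfl⟩ := hx
        obtain ⟨n, rfl⟩ := hy
        exact ⟨m + n, (zpow_add _ _ _).symm⟩
  obtain ⟨k, hk⟩ := key
  refine ⟨(φ.symm k : H), fun g hg => ?_⟩
  obtain ⟨n, hn⟩ := hk (φ ⟨g, Subgroup.subset_closure hg⟩)
  refine ⟨n, ?_⟩
  have := congrArg φ.symm hn
  rw [MulEquiv.symm_apply_apply, map_zpow] at this
  exact congrArg Subtype.val this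

end Commuting

/-! ### Almost fixed points -/

section Setup

variable {ι : Type} (St : TreeSetup ι)

instance : IsRTree St.Tb := St.tree

instance : IsIsometricSMul (FreeGroup ι) St.Tb := ⟨St.act_isom⟩

variable {St}

theorem dist_smul_inv {X : Type*} [MetricSpace X] {G : Type*} [Group G] [MulAction G X]
    [IsIsometricSMul G X] (g : G) (x y : X) : dist (g⁻¹ • x) y = dist x (g • y) := by
  rw [← dist_smul g, smul_inv_smul]

/-- Interior points of arcs of the completion belong to the tree. -/
theorem mem_Tsub_of_mem_seg {x y m : St.Tb} (hm : m ∈ seg x y) (hx : m ≠ x) (hy : m ≠ y) :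
    m ∈ St.Tsub := by
  obtain ⟨x', hx', h₁⟩ := St.dense.exists_dist_lt x (dist_pos.2 hx)
  obtain ⟨y', hy', h₂⟩ := St.dense.exists_dist_lt y (dist_pos.2 hy)
  refine St.sub_subtree x' hx' y' hy' ?_
  rcases mem_seg_or x' hm with h | h
  · rw [mem_seg] at h
    linarith [dist_comm m x, dist_nonneg (x := m) (y := x')]
  rcases mem_seg_or y' h with h | h
  · exact h
  · rw [mem_seg] at h
    linarith [dist_comm y y', dist_nonneg (x := m) (y := y'), dist_comm y' m]

theorem eq_one_of_fix {g : FreeGroup ι} {x y : St.Tb} (hxy : x ≠ y) (hx : g • x = x)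
    (hy : g • y = y) : g = 1 := by
  have hD := dist_pos.2 hxy
  have hfix : ∀ z ∈ seg x y, g • z = z := fun z hz => by
    have h := (smul_mem_seg g).2 hz
    rw [hx, hy] at h
    refine seg_unique h hz ?_
    nth_rw 1 [← hx]; rw [dist_smul]
  obtain ⟨a, ha, hda⟩ := exists_mem_seg (x := x) (y := y) (t := dist x y / 3) (by linarith)
    (by linarith)
  obtain ⟨b, hb, hdb⟩ := exists_mem_seg (x := x) (y := y) (t := dist x y / 2) (by linarith)
    (by linarith)
  have hin : ∀ z ∈ seg x y, 0 < dist x z → dist x z < dist x y → z ∈ St.Tsub :=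
    fun z hz h₁ h₂ => mem_Tsub_of_mem_seg hz (fun h => by subst h; simp at h₁)
      (fun h => by subst h; simp at h₂)
  refine St.arc_stab g a (hin a ha (by linarith) (by linarith)) b
    (hin b hb (by linarith) (by linarith)) (fun h => by subst h; linarith) ?_
  have hf : ∀ z ∈ seg a b, g • z = z := fun z hz => by
    have h := (smul_mem_seg g).2 hz
    rw [hfix a ha, hfix b hb] at h
    refine seg_unique h hz ?_
    nth_rw 1 [← hfix a ha]; rw [dist_smul]
  exact (image_congr hf).trans (image_id _)

theorem exists_near_ne (hT : St.Tsub.Nontrivial) {P : St.Tb} (hP : P ∈ St.Tsub) {ε : ℝ}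
    (hε : 0 < ε) : ∃ P' ∈ St.Tsub, P' ≠ P ∧ dist P P' < ε := by
  obtain ⟨Q, hQ, hne⟩ := hT.exists_ne P
  have hD := dist_pos.2 hne.symm
  obtain ⟨m, hm, hd⟩ := exists_mem_seg (x := P) (y := Q) (t := min (ε / 2) (dist P Q))
    (by positivity) (min_le_right _ _)
  refine ⟨m, St.sub_subtree P hP Q hQ hm, fun h => ?_, ?_⟩
  · rw [h, dist_self] at hd
    exact (lt_min (half_pos hε) hD).ne hd
  · rw [hd]; exact (min_le_left _ _).trans_lt (by linarith)

theorem exists_smul_near {P Q : St.Tb} (hP : P ∈ St.Tsub) (hQ : Q ∈ St.Tsub) {ε : ℝ}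
    (hε : 0 < ε) : ∃ g : FreeGroup ι, dist (g • P) Q < ε := by
  obtain ⟨_, ⟨g, rfl⟩, h⟩ := Metric.mem_closure_iff.1 (St.dense_orbits P hP hQ) ε hε
  exact ⟨g, by rwa [dist_comm]⟩

theorem exists_smul_near' {P Q : St.Tb} (hP : P ∈ St.Tsub) {ε : ℝ}
    (hε : 0 < ε) : ∃ g : FreeGroup ι, dist (g • P) Q < ε := by
  obtain ⟨Q', hQ', h⟩ := St.dense.exists_dist_lt Q (half_pos hε)
  obtain ⟨g, hg⟩ := exists_smul_near hP hQ' (half_pos hε)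
  refine ⟨g, (dist_triangle_right _ _ Q').trans_lt ?_⟩
  linarith

theorem not_fixed (hT : St.Tsub.Nontrivial) (y : St.Tb) : ∃ g : FreeGroup ι, g • y ≠ y := by
  by_contra! h
  obtain ⟨P, hP, Q, hQ, hne⟩ := hT
  have key : ∀ x : St.Tb, dist y P = dist y x := fun x => by
    refine eq_of_forall_dist_le fun ε hε => ?_
    obtain ⟨g, hg⟩ := exists_smul_near' (Q := x) hP hε
    rw [← dist_smul g y P, h g, Real.dist_eq, dist_comm y, dist_comm y]
    exact (abs_dist_sub_le _ _ _).trans hg.le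
  have h0 := key y
  rw [dist_self] at h0
  have h1 := key Q
  rw [h0] at h1
  exact hne ((dist_eq_zero.1 h0).symm.trans (dist_eq_zero.1 h1.symm))

theorem exists_translation {R z : St.Tb} {ε : ℝ} (hε : 0 < ε) (hD : 100 * ε ≤ dist R z)
    {g : FreeGroup ι} (hR : dist R (g • R) < ε) (hz : dist z (g • z) < ε) :
    ∃ τ : ℝ, |τ| ≤ ε ∧ ∀ y ∈ seg R z, 6 * ε ≤ dist R y → dist R y ≤ dist R z - 6 * ε →
      g • y ∈ seg R z ∧ dist R (g • y) = dist R y + τ := by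
  have hmem : ∀ y ∈ seg R z, ε < dist R y → dist R y < dist R z - ε → g • y ∈ seg R z := by
    intro y hy h₁ h₂
    have h := (smul_mem_seg g).2 hy
    rcases mem_seg_or R h with h | h
    · rw [mem_seg, dist_smul] at h
      linarith [dist_comm R (g • R), dist_nonneg (x := g • y) (y := R)]
    rcases mem_seg_or z h with h | h
    · exact h
    · rw [mem_seg, dist_smul] at h
      rw [mem_seg] at hy
      linarith [dist_nonneg (x := z) (y := g • y)]
  have hpos : ∀ y, |dist R (g • y) - dist R y| ≤ ε := fun y => by
    rw [← dist_smul g R y, ]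
    exact (abs_dist_sub_le _ _ _).trans hR.le
  obtain ⟨c, hc, hdc⟩ := exists_mem_seg (x := R) (y := z) (t := 3 * ε) (by linarith) (by linarith)
  refine ⟨dist R (g • c) - dist R c, hpos c, fun y hy h₁ h₂ => ?_⟩
  have hgy := hmem y hy (by linarith) (by linarith)
  refine ⟨hgy, ?_⟩
  have e := dist_smul g c y
  rw [seg_dist (hmem c hc (by linarith) (by linarith)) hgy, seg_dist hc hy] at e
  have h₃ := abs_le.1 (hpos c)
  have h₄ := abs_le.1 (hpos y)
  rw [abs_of_nonpos (by linarith), abs_of_nonpos (by linarith)] at e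
  linarith

/-- Two distinct points of the completion are not simultaneously almost fixed by a non-trivial
element. -/
theorem exists_indep {R z : St.Tb} (hne : R ≠ z) :
    ∃ ε > 0, ∀ g : FreeGroup ι, dist R (g • R) < ε → dist z (g • z) < ε → g = 1 := by
  by_contra! hcon
  have hD := dist_pos.2 hne
  set D := dist R z with hDdef
  set ε := D / 100 with hεdef
  have hε : 0 < ε := by positivity
  obtain ⟨a, ha, hda⟩ := exists_mem_seg (x := R) (y := z) (t := D / 3) (by linarith)
    (by linarith)
  obtain ⟨b, hb, hdb⟩ := exists_mem_seg (x := R) (y := z) (t := D / 2) (by linarith)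
    (by linarith)
  have hab : a ≠ b := fun h => by subst h; linarith
  have htr : ∀ g : FreeGroup ι, ∀ η > 0, η ≤ ε → dist R (g • R) < η → dist z (g • z) < η →
      ∃ τ : ℝ, |τ| ≤ η ∧ ∀ y ∈ seg R z, 6 * ε ≤ dist R y → dist R y ≤ D - 6 * ε →
      g • y ∈ seg R z ∧ dist R (g • y) = dist R y + τ := fun g η hη hle h₁ h₂ => by
    obtain ⟨τ, hτ, h⟩ := exists_translation hη (by linarith) h₁ h₂
    exact ⟨τ, hτ, fun y hy h₃ h₄ => h y hy (by linarith) (by linarith)⟩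
  have hcomm : ∀ g ∈ {g : FreeGroup ι | dist R (g • R) < ε ∧ dist z (g • z) < ε},
      ∀ h ∈ {g : FreeGroup ι | dist R (g • R) < ε ∧ dist z (g • z) < ε}, g * h = h * g := by
    rintro g ⟨hg₁, hg₂⟩ h ⟨hh₁, hh₂⟩
    obtain ⟨τ, hτ, hg⟩ := htr g ε hε le_rfl hg₁ hg₂
    obtain ⟨σ, hσ, hh⟩ := htr h ε hε le_rfl hh₁ hh₂
    rw [abs_le] at hτ hσ
    have key : ∀ y ∈ seg R z, D / 3 ≤ dist R y → dist R y ≤ D / 2 →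
        (g * h) • y = (h * g) • y := fun y hy h₁ h₂ => by
      obtain ⟨m₁, d₁⟩ := hg y hy (by linarith) (by linarith)
      obtain ⟨m₂, d₂⟩ := hh y hy (by linarith) (by linarith)
      obtain ⟨m₃, d₃⟩ := hg _ m₂ (by linarith) (by linarith)
      obtain ⟨m₄, d₄⟩ := hh _ m₁ (by linarith) (by linarith)
      rw [mul_smul, mul_smul]
      exact seg_unique m₃ m₄ (by linarith)
    have := eq_one_of_fix (g := (h * g)⁻¹ * (g * h)) hab
      (by rw [mul_smul, key a ha (by linarith) (by linarith), inv_smul_smul])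
      (by rw [mul_smul, key b hb (by linarith) (by linarith), inv_smul_smul])
    exact (inv_mul_eq_one.1 this).symm
  obtain ⟨k, hk⟩ := exists_zpow_of_commute _ hcomm
  obtain ⟨g₁, hR₁, hz₁, hne₁⟩ := hcon ε hε
  obtain ⟨τ, hτ, hg₁⟩ := htr g₁ ε hε le_rfl hR₁ hz₁
  obtain ⟨n₁, e₁⟩ := hk g₁ ⟨hR₁, hz₁⟩
  have hn₁ : n₁ ≠ 0 := fun h => hne₁ (by rw [e₁, h, zpow_zero])
  have hτ0 : τ ≠ 0 := by
    rintro rfl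
    refine hne₁ (eq_one_of_fix hab ?_ ?_)
    · obtain ⟨m, d⟩ := hg₁ a ha (by linarith) (by linarith)
      exact seg_unique m ha (by linarith)
    · obtain ⟨m, d⟩ := hg₁ b hb (by linarith) (by linarith)
      exact seg_unique m hb (by linarith)
  have hτp := abs_pos.2 hτ0
  have hn₁p : (0 : ℝ) < n₁.natAbs := by exact_mod_cast Int.natAbs_pos.2 hn₁
  obtain ⟨g₂, hR₂, hz₂, hne₂⟩ := hcon (min ε (|τ| / (2 * n₁.natAbs))) (by positivity)
  obtain ⟨σ, hσ, hg₂⟩ := htr g₂ _ (by positivity) (min_le_left _ _) hR₂ hz₂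
  obtain ⟨n₂, e₂⟩ := hk g₂ ⟨hR₂.trans_le (min_le_left _ _), hz₂.trans_le (min_le_left _ _)⟩
  have hn₂ : n₂ ≠ 0 := fun h => hne₂ (by rw [e₂, h, zpow_zero])
  have hpow : ∀ (g : FreeGroup ι) (n : ℤ), dist b (g ^ n • b) = dist b (g ^ n.natAbs • b) := by
    intro g n
    rcases Int.natAbs_eq n with h | h
    · nth_rw 1 [h]; rw [zpow_natCast]
    · nth_rw 1 [h]
      rw [zpow_neg, zpow_natCast, dist_comm, dist_smul_inv]
  have hup : dist b (g₂ ^ n₁ • b) ≤ n₁.natAbs * |σ| := by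
    rw [hpow]
    have h1 : dist b (g₂ • b) ≤ |σ| := by
      obtain ⟨m, d⟩ := hg₂ b hb (by linarith) (by linarith)
      rw [seg_dist hb m, d, abs_sub_comm, add_sub_cancel_left]
    generalize n₁.natAbs = n
    induction n with
    | zero => simp
    | succ n ih =>
      rw [pow_succ, mul_smul]
      refine (dist_triangle _ (g₂ ^ n • b) _).trans ?_
      rw [dist_smul]; push_cast; linarith
  have hlow : dist b (g₁ ^ n₂ • b) = n₂.natAbs * |τ| := by
    rw [hpow]
    have hs : ∀ i : ℕ, g₁ ^ (i + 1) • b = g₁ ^ i • g₁ • b := fun i => by rw [pow_succ, mul_smul]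
    have hs' : ∀ i : ℕ, g₁ ^ (i + 2) • b = g₁ ^ i • g₁ • g₁ • b := fun i => by
      rw [pow_add, pow_two, mul_smul, mul_smul]
    obtain ⟨m₁, d₁⟩ := hg₁ b hb (by linarith) (by linarith)
    obtain ⟨m₂, d₂⟩ := hg₁ _ m₁ (by linarith [(abs_le.1 hτ).1]) (by linarith [(abs_le.1 hτ).2])
    have := dist_chain (x := fun i => g₁ ^ i • b) hτp (fun i => ?_) (fun i => ?_) n₂.natAbs
    · simpa using this
    · simp only [hs]
      rw [dist_smul, seg_dist hb m₁, d₁, abs_sub_comm, add_sub_cancel_left]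
    · simp only [hs']
      rw [dist_smul, seg_dist hb m₂, d₂, d₁, abs_sub_comm, add_assoc, add_sub_cancel_left,
        ← two_mul, abs_mul, abs_two]
  have heq : g₂ ^ n₁ = g₁ ^ n₂ := by rw [e₁, e₂, ← zpow_mul, ← zpow_mul, mul_comm]
  rw [heq, hlow] at hup
  have h₁ : (1 : ℝ) ≤ n₂.natAbs := by exact_mod_cast Int.natAbs_pos.2 hn₂
  have h₂ : n₁.natAbs * |σ| ≤ |τ| / 2 := by
    have := mul_le_mul_of_nonneg_left (hσ.trans (min_le_right _ _)) hn₁p.le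
    refine this.trans_eq ?_
    field_simp
  have := mul_le_mul_of_nonneg_right h₁ hτp.le
  linarith

/-- The system of isometries induced on a compact set has independent generators. -/
theorem eq_of_forall_mem_prefixN_smul [DecidableEq ι] {K : Set St.Tb} (hK : IsCompact K)
    {X : InfWord ι} {R z : St.Tb} {n₀ : ℕ} (hR : ∀ n ≥ n₀, R ∈ X.prefixN n • K)
    (hz : ∀ n ≥ n₀, z ∈ X.prefixN n • K) : R = z := by
  by_contra hne
  obtain ⟨ε, hε, hind⟩ := exists_indep hne
  have hmem : ∀ n, ((X.prefixN (n + n₀))⁻¹ • R, (X.prefixN (n + n₀))⁻¹ • z) ∈ K ×ˢ K := fun n =>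
    ⟨mem_smul_set_iff_inv_smul_mem.1 (hR _ (by omega)),
      mem_smul_set_iff_inv_smul_mem.1 (hz _ (by omega))⟩
  obtain ⟨p, -, φ, hφ, hlim⟩ := (hK.prod hK).tendsto_subseq hmem
  obtain ⟨N, hN⟩ := Metric.cauchySeq_iff.1 hlim.cauchySeq ε hε
  have h := hN N le_rfl (N + 1) (by omega)
  rw [Prod.dist_eq, max_lt_iff] at h
  have h1 := hind (X.prefixN (φ N + n₀) * (X.prefixN (φ (N + 1) + n₀))⁻¹)
    (by rw [mul_smul, ← dist_smul_inv]; exact h.1) (by rw [mul_smul, ← dist_smul_inv]; exact h.2)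
  have h2 := congrArg (fun g => g.toWord.length) (mul_inv_eq_one.1 h1)
  simp only [InfWord.length_prefixN] at h2
  have := hφ (Nat.lt_succ_self N)
  simp only [Nat.succ_eq_add_one] at this
  omega

theorem exists_noncomm (hT : St.Tsub.Nontrivial) {P : St.Tb} (hP : P ∈ St.Tsub) {ε : ℝ}
    (hε : 0 < ε) : ∃ s₁ s₂ : FreeGroup ι, s₁ * s₂ ≠ s₂ * s₁ ∧ dist P (s₁ • P) < ε ∧
      dist P (s₂ • P) < ε := by
  by_contra! hcon
  have hcomm : ∀ s₁ s₂ : FreeGroup ι, dist P (s₁ • P) < ε → dist P (s₂ • P) < ε →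
      s₁ * s₂ = s₂ * s₁ := fun s₁ s₂ h₁ h₂ => by
    by_contra hne; exact (hcon s₁ s₂ hne h₁).not_gt h₂
  obtain ⟨P₁, hP₁, hne, hd⟩ := exists_near_ne hT hP (half_pos hε)
  obtain ⟨η, hη, hind⟩ := exists_indep hne.symm
  set δ := min η ε / 4 with hδdef
  have hδ : 0 < δ := by positivity
  have hδ1 : 4 * δ ≤ η := by rw [hδdef]; linarith [min_le_left η ε]
  have hδ2 : 4 * δ ≤ ε := by rw [hδdef]; linarith [min_le_right η ε]
  obtain ⟨P₂, hP₂, hne₂, hd₂⟩ := exists_near_ne hT hP (half_pos hδ)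
  obtain ⟨s, hs⟩ := exists_smul_near hP hP₂ (dist_pos.2 hne₂.symm)
  have hsP : dist P (s • P) < δ := by
    have := dist_triangle P P₂ (s • P)
    rw [dist_comm P₂] at this; linarith
  have hs1 : s ≠ 1 := by
    rintro rfl
    rw [one_smul] at hs; exact lt_irrefl _ hs
  obtain ⟨k, hk⟩ := exists_smul_near hP hP₁ hδ
  have hkP : dist P (k • P) < ε := by
    have := dist_triangle P P₁ (k • P)
    rw [dist_comm P₁] at this; linarith
  have hsk := hcomm s k (by linarith) hkP
  refine hs1 (hind s (by linarith) ?_)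
  have e : dist (k • P) (s • k • P) = dist P (s • P) := by
    rw [← mul_smul, hsk, mul_smul, dist_smul]
  have h1 := dist_triangle4 P₁ (k • P) (s • k • P) (s • P₁)
  rw [e, dist_smul, dist_comm P₁ (k • P)] at h1
  linarith

end Setup

/-! ### Lengths of paths along words -/

section Path

open FreeGroup (of toWord invRev Red reduce)

variable {ι : Type} {X : Type} [MetricSpace X] [MulAction (FreeGroup ι) X]

/-- `PathLE K L x y r`: there is a path of length at most `r` from `x` to `L • y` that travels
through the translates of `K` along the prefixes of the word `L`. -/
def PathLE (K : Set X) : List (ι × Bool) → K → K → ℝ → Prop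
  | [], x, y, r => dist x y ≤ r
  | z :: L, x, y, r => ∃ P P' : K, FreeGroup.mk [z] • (P' : X) = P ∧ PathLE K L P' y (r - dist x P)

namespace PathLE

variable {K : Set X} {L L₁ L₂ : List (ι × Bool)} {x y : K} {r : ℝ}

theorem mono (h : PathLE K L x y r) {r' : ℝ} (hr : r ≤ r') : PathLE K L x y r' := by
  induction L generalizing x r r' with
  | nil => exact le_trans h hr
  | cons z L ih =>
    obtain ⟨P, P', e, h⟩ := h
    exact ⟨P, P', e, ih h (by linarith)⟩

theorem nonneg (h : PathLE K L x y r) : 0 ≤ r := by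
  induction L generalizing x r with
  | nil => exact dist_nonneg.trans h
  | cons z L ih =>
    obtain ⟨P, P', e, h⟩ := h
    linarith [ih h, dist_nonneg (x := x) (y := P)]

theorem start (h : PathLE K L x y r) (x' : K) : PathLE K L x' y (r + dist x' x) := by
  cases L with
  | nil =>
    have h : dist x y ≤ r := h
    show dist x' y ≤ _
    linarith [dist_triangle x' x y]
  | cons z L =>
    obtain ⟨P, P', e, h⟩ := h
    exact ⟨P, P', e, h.mono (by linarith [dist_triangle x' x P])⟩

theorem append_iff : PathLE K (L₁ ++ L₂) x y r ↔
    ∃ m s, PathLE K L₁ x m s ∧ PathLE K L₂ m y (r - s) := by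
  induction L₁ generalizing x r with
  | nil =>
    constructor
    · intro h
      exact ⟨x, 0, (dist_self x).le, by simpa using h⟩
    · rintro ⟨m, s, h₁, h₂⟩
      have h₁ : dist x m ≤ s := h₁
      exact (h₂.start x).mono (by linarith)
  | cons z L ih =>
    constructor
    · rintro ⟨P, P', e, h⟩
      obtain ⟨m, s, h₁, h₂⟩ := ih.1 h
      exact ⟨m, s + dist x P, ⟨P, P', e, by simpa using h₁⟩, h₂.mono (by linarith)⟩
    · rintro ⟨m, s, ⟨P, P', e, h₁⟩, h₂⟩
      exact ⟨P, P', e, ih.2 ⟨m, _, h₁, h₂.mono (by linarith)⟩⟩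

theorem append {m : K} {s : ℝ} (h₁ : PathLE K L₁ x m s) (h₂ : PathLE K L₂ m y r) :
    PathLE K (L₁ ++ L₂) x y (s + r) :=
  append_iff.2 ⟨m, s, h₁, by simpa using h₂⟩

theorem of_append (h : PathLE K (L₁ ++ L ++ L₂) x y r) : ∃ x' y', PathLE K L x' y' r := by
  obtain ⟨m, s, h₁, h₂⟩ := append_iff.1 h
  obtain ⟨m', s', h₃, h₄⟩ := append_iff.1 h₁
  exact ⟨m', m, h₄.mono (by linarith [h₂.nonneg, h₃.nonneg])⟩

theorem symm (h : PathLE K L x y r) : PathLE K (invRev L) y x r := by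
  induction L generalizing x r with
  | nil => rw [FreeGroup.invRev_empty]; show dist y x ≤ r; rw [dist_comm]; exact h
  | cons z L ih =>
    obtain ⟨P, P', e, h⟩ := h
    rw [FreeGroup.invRev_cons]
    have h₁ : PathLE K (invRev [z]) P' x (dist x P) := by
      refine ⟨P', P, ?_, ?_⟩
      · rw [← e]
        exact inv_smul_smul (FreeGroup.mk [z]) (P' : X)
      · show dist P x ≤ _
        rw [dist_self, sub_zero, dist_comm]
    exact ((ih h).append h₁).mono (by linarith)

variable [IsIsometricSMul (FreeGroup ι) X]

theorem cancel {z : ι × Bool} (h : PathLE K (z :: linv z :: L) x y r) : PathLE K L x y r := by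
  obtain ⟨P, P', e, Q, Q', e', h⟩ := h
  refine (h.start x).mono ?_
  have : dist P Q' = dist P' Q := by
    rw [Subtype.dist_eq, Subtype.dist_eq, ← e, ← e', mk_linv, ← dist_smul (FreeGroup.mk [z])⁻¹,
      inv_smul_smul]
  linarith [dist_triangle x P Q']

theorem red (hr : Red L₁ L₂) (h : PathLE K L₁ x y r) : PathLE K L₂ x y r := by
  induction hr with
  | refl => exact h
  | tail _ hs ih =>
    cases hs with
    | @not A B a b =>
      obtain ⟨m, s, h₁, h₂⟩ := append_iff.1 ih
      exact append_iff.2 ⟨m, s, h₁, h₂.cancel⟩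

theorem dist_le (h : PathLE K L x y r) : dist (x : X) (FreeGroup.mk L • (y : X)) ≤ r := by
  induction L generalizing x r with
  | nil => exact (congrArg _ (one_smul _ _)).trans_le h
  | cons z L ih =>
    obtain ⟨P, P', e, h⟩ := h
    rw [mk_cons, mul_smul]
    refine (dist_triangle _ (P : X) _).trans ?_
    have := ih h
    rw [← dist_smul (FreeGroup.mk [z]), e] at this
    rw [← Subtype.dist_eq]
    linarith

omit [IsIsometricSMul (FreeGroup ι) X] in
theorem mem_of_zero (h : PathLE K L x y 0) (n : ℕ) :
    (x : X) ∈ FreeGroup.mk (L.take n) • K := by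
  have hone : ∀ x : K, (x : X) ∈ (1 : FreeGroup ι) • K := fun x => by
    rw [one_smul]; exact x.2
  induction L generalizing x n with
  | nil => rw [List.take_nil]; exact hone x
  | cons z L ih =>
    cases n with
    | zero => exact hone x
    | succ n =>
      obtain ⟨P, P', e, h⟩ := h
      have h0 : dist x P = 0 := by linarith [h.nonneg, dist_nonneg (x := x) (y := P)]
      rw [h0, sub_zero] at h
      rw [dist_eq_zero.1 h0, ← e, List.take_succ_cons, mk_cons, mul_smul]
      exact smul_mem_smul_set (ih h n)

theorem isClosed (hK : IsCompact K) (L : List (ι × Bool)) :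
    IsClosed {p : (K × K) × ℝ | PathLE K L p.1.1 p.1.2 p.2} := by
  have := isCompact_iff_compactSpace.1 hK
  induction L with
  | nil => exact isClosed_le (by fun_prop) (by fun_prop)
  | cons z L ih =>
    have hcl : IsClosed {q : (K × K) × ((K × K) × ℝ) | FreeGroup.mk [z] • (q.1.2 : X) = q.1.1 ∧
        PathLE K L q.1.2 q.2.1.2 (q.2.2 - dist q.2.1.1 q.1.1)} := by
      refine IsClosed.inter (isClosed_eq ?_ (by fun_prop)) ?_
      · exact ((isometry_smul X (FreeGroup.mk [z])).continuous).comp (by fun_prop)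
      · exact ih.preimage (f := fun q : (K × K) × ((K × K) × ℝ) =>
          ((q.1.2, q.2.1.2), q.2.2 - dist q.2.1.1 q.1.1)) (by fun_prop)
    convert isClosedMap_snd_of_compactSpace _ hcl
    ext p
    constructor
    · rintro ⟨P, P', h⟩; exact ⟨((P, P'), p), h, rfl⟩
    · rintro ⟨⟨⟨P, P'⟩, p⟩, h, rfl⟩; exact ⟨P, P', h⟩

theorem exists_zero_of_forall_pos (hK : IsCompact K) (h : ∀ δ > 0, ∃ x y, PathLE K L x y δ) :
    ∃ x y, PathLE K L x y 0 := by
  have := isCompact_iff_compactSpace.1 hK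
  have hcl := isClosedMap_snd_of_compactSpace _ (isClosed hK L)
  have h0 : (0 : ℝ) ∈ Prod.snd '' {p : (K × K) × ℝ | PathLE K L p.1.1 p.1.2 p.2} := by
    rw [← hcl.closure_eq, Metric.mem_closure_iff]
    intro δ hδ
    obtain ⟨x, y, h⟩ := h (δ / 2) (half_pos hδ)
    refine ⟨δ / 2, ⟨((x, y), δ / 2), h, rfl⟩, ?_⟩
    rw [dist_zero_left, Real.norm_eq_abs, abs_of_pos (half_pos hδ)]
    linarith
  obtain ⟨⟨⟨x, y⟩, s⟩, h, hs⟩ := h0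
  dsimp only at hs
  subst hs
  exact ⟨x, y, h⟩

omit [IsIsometricSMul (FreeGroup ι) X] in
theorem exists_of_letters (hl : ∀ z : ι × Bool, ∃ P P' : K, FreeGroup.mk [z] • (P' : X) = P)
    (L : List (ι × Bool)) (x y : K) : ∃ r, PathLE K L x y r := by
  induction L generalizing x with
  | nil => exact ⟨_, le_rfl⟩
  | cons z L ih =>
    obtain ⟨P, P', e⟩ := hl z
    obtain ⟨r, h⟩ := ih P'
    exact ⟨r + dist x P, P, P', e, by simpa using h⟩

end PathLE

variable [DecidableEq ι] {K : Set X}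

/-- The infimum of the lengths of the paths from `x` to `w • y`. -/
noncomputable def pathCost (K : Set X) (w : FreeGroup ι) (x y : K) : ℝ :=
  sInf {r | PathLE K w.toWord x y r}

/-- The disjoint union of the translates of `K`. -/
structure TranslateUnion (ι : Type) (K : Set X) where
  fst : FreeGroup ι
  snd : K

instance : MulAction (FreeGroup ι) (TranslateUnion ι K) where
  smul g p := ⟨g * p.1, p.2⟩
  one_smul p := by cases p; exact congrArg (TranslateUnion.mk · _) (one_mul _)
  mul_smul g h p := by cases p; exact congrArg (TranslateUnion.mk · _) (mul_assoc _ _ _)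

variable [IsIsometricSMul (FreeGroup ι) X]

theorem pathLE_pathCost (hK : IsCompact K)
    (hl : ∀ z : ι × Bool, ∃ P P' : K, FreeGroup.mk [z] • (P' : X) = P)
    (w : FreeGroup ι) (x y : K) : PathLE K w.toWord x y (pathCost K w x y) := by
  have hcl : IsClosed {r | PathLE K w.toWord x y r} :=
    (PathLE.isClosed hK w.toWord).preimage (f := fun r : ℝ => ((x, y), r)) (by fun_prop)
  exact hcl.csInf_mem (PathLE.exists_of_letters hl _ _ _) ⟨0, fun _ hr => PathLE.nonneg hr⟩

omit [IsIsometricSMul (FreeGroup ι) X] in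
theorem pathCost_le {w : FreeGroup ι} {x y : K} {r : ℝ} (h : PathLE K w.toWord x y r) :
    pathCost K w x y ≤ r :=
  csInf_le ⟨0, fun _ hr => PathLE.nonneg hr⟩ h

/-- The path pseudometric on the disjoint union of the translates of `K`. -/
@[reducible] noncomputable def pathPseudoMetric (hK : IsCompact K)
    (hl : ∀ z : ι × Bool, ∃ P P' : K, FreeGroup.mk [z] • (P' : X) = P) :
    PseudoMetricSpace (TranslateUnion ι K) where
  dist p q := pathCost K (p.1⁻¹ * q.1) p.2 q.2
  dist_self p := by
    refine le_antisymm (pathCost_le ?_) (pathLE_pathCost hK hl _ _ _).nonneg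
    rw [inv_mul_cancel, FreeGroup.toWord_one]
    exact (dist_self _).le
  dist_comm p q := by
    have key : ∀ p q : TranslateUnion ι K,
        pathCost K (p.1⁻¹ * q.1) p.2 q.2 ≤ pathCost K (q.1⁻¹ * p.1) q.2 p.2 := fun p q => by
      refine pathCost_le ?_
      have := (pathLE_pathCost hK hl (q.1⁻¹ * p.1) q.2 p.2).symm
      rwa [← FreeGroup.toWord_inv, mul_inv_rev, inv_inv] at this
    exact le_antisymm (key p q) (key q p)
  dist_triangle p q s := by
    refine pathCost_le ?_
    have e : p.1⁻¹ * s.1 = (p.1⁻¹ * q.1) * (q.1⁻¹ * s.1) := by group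
    rw [e, FreeGroup.toWord_mul]
    exact ((pathLE_pathCost hK hl _ _ _).append (pathLE_pathCost hK hl _ _ _)).red
      FreeGroup.reduce.red

end Path

/-! ### The tree associated to the induced system of isometries -/

section Assoc

variable {ι : Type} {St : TreeSetup ι} {K : Set St.Tb} (IA : InducedAssoc St K)

instance : IsRTree IA.TK := IA.tree

instance : IsIsometricSMul (FreeGroup ι) IA.TK := ⟨IA.act_isom⟩

/-- The translate `g K` inside `T_𝒦`. -/
def piece (g : FreeGroup ι) : Set IA.TK := g • range IA.emb

variable {IA}

theorem mem_piece {g : FreeGroup ι} {p : IA.TK} : p ∈ piece IA g ↔ ∃ x : K, g • IA.emb x = p := by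
  rw [piece, mem_smul_set]
  exact ⟨fun ⟨_, ⟨x, rfl⟩, h⟩ => ⟨x, h⟩, fun ⟨x, h⟩ => ⟨_, ⟨x, rfl⟩, h⟩⟩

theorem smul_mem_piece (g : FreeGroup ι) (x : K) : g • IA.emb x ∈ piece IA g := mem_piece.2 ⟨x, rfl⟩

theorem exists_mem_piece (p : IA.TK) : ∃ g, p ∈ piece IA g := by
  obtain ⟨g, x, rfl⟩ := IA.orbit_meets p
  exact ⟨g, smul_mem_piece g x⟩

theorem smul_mem_piece_iff {g h : FreeGroup ι} {p : IA.TK} :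
    h • p ∈ piece IA (h * g) ↔ p ∈ piece IA g := by
  rw [piece, piece, mul_smul, smul_mem_smul_set_iff]

theorem jmap_smul_emb (g : FreeGroup ι) (x : K) : IA.jmap (g • IA.emb x) = g • (x : St.Tb) := by
  rw [IA.jmap_equivariant, IA.jmap_emb]

theorem jmap_mem {g : FreeGroup ι} {p : IA.TK} (h : p ∈ piece IA g) : IA.jmap p ∈ g • K := by
  obtain ⟨x, rfl⟩ := mem_piece.1 h
  rw [jmap_smul_emb]
  exact smul_mem_smul_set x.2

theorem exists_mem_piece_jmap {g : FreeGroup ι} {z : St.Tb} (h : z ∈ g • K) :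
    ∃ p ∈ piece IA g, IA.jmap p = z := by
  obtain ⟨x, hx, rfl⟩ := mem_smul_set.1 h
  exact ⟨_, smul_mem_piece g ⟨x, hx⟩, jmap_smul_emb g ⟨x, hx⟩⟩

theorem dist_jmap_of_mem_piece {g : FreeGroup ι} {p q : IA.TK} (hp : p ∈ piece IA g)
    (hq : q ∈ piece IA g) : dist (IA.jmap p) (IA.jmap q) = dist p q := by
  obtain ⟨x, rfl⟩ := mem_piece.1 hp
  obtain ⟨y, rfl⟩ := mem_piece.1 hq
  rw [jmap_smul_emb, jmap_smul_emb, dist_smul, dist_smul, IA.emb_isom.dist_eq, Subtype.dist_eq]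

theorem eq_of_jmap_eq {g : FreeGroup ι} {p q : IA.TK} (hp : p ∈ piece IA g)
    (hq : q ∈ piece IA g) (h : IA.jmap p = IA.jmap q) : p = q := by
  rw [← dist_eq_zero, ← dist_jmap_of_mem_piece hp hq, h, dist_self]

theorem isSubtree_piece (g : FreeGroup ι) : IsSubtree (piece IA g) := by
  intro p hp q hq r hr
  rw [piece, mem_smul_set_iff_inv_smul_mem] at *
  exact IA.emb_subtree _ hp _ hq ((smul_mem_seg g⁻¹).2 hr)

theorem isClosed_piece (hK : IsCompact K) (g : FreeGroup ι) : IsClosed (piece IA g) := by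
  have := isCompact_iff_compactSpace.1 hK
  rw [piece, ← image_smul]
  exact ((isCompact_range IA.emb_isom.continuous).image (isometry_smul _ g).continuous).isClosed

theorem eventually_common_piece (hK : IsCompact K) (p q c : IA.TK) :
    ∀ᶠ c' in 𝓝[seg p q] c, ∃ w, c ∈ piece IA w ∧ c' ∈ piece IA w := by
  obtain ⟨F, hF⟩ := IA.seg_cover p q
  have h : ∀ᶠ c' in 𝓝 c, ∀ w ∈ F, c ∉ piece IA w → c' ∉ piece IA w := by
    rw [Finset.eventually_all]
    intro w _
    by_cases hw : c ∈ piece IA w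
    · exact Eventually.of_forall fun _ h => absurd hw h
    · filter_upwards [(isClosed_piece hK w).isOpen_compl.mem_nhds hw] with c' hc' _ using hc'
  filter_upwards [nhdsWithin_le_nhds h, self_mem_nhdsWithin] with c' h₁ h₂
  obtain ⟨w, hw, hmem⟩ := mem_iUnion₂.1 (hF h₂)
  refine ⟨w, ?_, hmem⟩
  by_contra hcw
  exact h₁ w hw hcw hmem

/-- A continuous map out of an ℝ-tree that is locally `1`-Lipschitz at each point of a segment
does not increase the distance between the endpoints. -/
theorem dist_le_of_local {T M : Type*} [MetricSpace T] [IsRTree T] [MetricSpace M] {f : T → M}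
    (hf : Continuous f) {p q : T}
    (h : ∀ c ∈ seg p q, ∀ᶠ c' in 𝓝[seg p q] c, dist (f c) (f c') ≤ dist c c') :
    dist (f p) (f q) ≤ dist p q := by
  obtain ⟨γ, h0, h1, hcont, hmem, hγ⟩ := exists_geodesic p q
  set D := dist p q with hD
  have key := forall_geodesic_of_local hcont hmem (S := {t | dist (f p) (f (γ t)) ≤ t}) ?_ ?_ h ?_
  · rw [← hD] at key
    have key : dist (f p) (f (γ D)) ≤ D := key
    rwa [h1] at key
  · have : {t | dist (f p) (f (γ t)) ≤ t} ∩ Icc 0 D =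
        {t ∈ Icc 0 D | dist (f p) (f (γ t)) ≤ t} := by ext; simp [and_comm]
    rw [this]
    exact isClosed_Icc.isClosed_le ((continuous_const.dist hf).comp_continuousOn hcont)
      continuousOn_id
  · simp [h0]
  · intro t ht s ht0 hts hsD hloc
    rw [hγ t ⟨ht0, hts.le.trans hsD⟩ s ⟨ht0.trans hts.le, hsD⟩,
      abs_of_nonpos (by linarith)] at hloc
    have ht : dist (f p) (f (γ t)) ≤ t := ht
    show dist (f p) (f (γ s)) ≤ s
    linarith [dist_triangle (f p) (f (γ t)) (f (γ s))]

theorem dist_le_of_pieces (hK : IsCompact K) {M : Type*} [MetricSpace M] {f : IA.TK → M}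
    (hf : Continuous f)
    (h : ∀ w, ∀ p ∈ piece IA w, ∀ q ∈ piece IA w, dist (f p) (f q) ≤ dist p q) (p q : IA.TK) :
    dist (f p) (f q) ≤ dist p q := by
  refine dist_le_of_local hf fun c _ => ?_
  filter_upwards [eventually_common_piece hK p q c] with c' ⟨w, h₁, h₂⟩ using h w _ h₁ _ h₂

theorem dist_jmap_le (hK : IsCompact K) (p q : IA.TK) :
    dist (IA.jmap p) (IA.jmap q) ≤ dist p q :=
  dist_le_of_pieces hK IA.jmap_morphism.1 (fun _ _ hp _ hq => (dist_jmap_of_mem_piece hp hq).le) p q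

theorem emb_eq_of_letter {z : ι × Bool} {x x' : K}
    (h : FreeGroup.mk [z] • (x' : St.Tb) = x) : FreeGroup.mk [z] • IA.emb x' = IA.emb x := by
  obtain ⟨i, b⟩ := z
  cases b with
  | true =>
    have h : FreeGroup.of i • (x' : St.Tb) = x := h
    have h' : (FreeGroup.of i)⁻¹ • (x : St.Tb) = x' := by rw [← h, inv_smul_smul]
    have := IA.compat i x (by rw [h']; exact x'.2)
    rw [inv_smul_eq_iff] at this
    rw [this]
    show FreeGroup.of i • _ = FreeGroup.of i • _
    congr 2
    exact Subtype.ext h'.symm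
  | false =>
    have h : (FreeGroup.of i)⁻¹ • (x' : St.Tb) = x := h
    have := IA.compat i x' (by rw [h]; exact x.2)
    refine this.trans ?_
    congr 1
    exact Subtype.ext h

theorem PathLE.emb_eq {L : List (ι × Bool)} {x y : K} (h : PathLE K L x y 0) (n : ℕ) :
    IA.emb x ∈ piece IA (FreeGroup.mk (L.take n)) := by
  have hone : ∀ x : K, IA.emb x ∈ piece IA (1 : FreeGroup ι) := fun x =>
    mem_piece.2 ⟨x, one_smul _ _⟩
  induction L generalizing x n with
  | nil => rw [List.take_nil]; exact hone x
  | cons z L ih =>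
    cases n with
    | zero => exact hone x
    | succ n =>
      obtain ⟨P, P', e, h⟩ := h
      have h0 : dist x P = 0 := by linarith [h.nonneg, dist_nonneg (x := x) (y := P)]
      rw [h0, sub_zero] at h
      rw [dist_eq_zero.1 h0, ← emb_eq_of_letter e, List.take_succ_cons, mk_cons]
      exact smul_mem_piece_iff.2 (ih h n)

theorem exists_letter (hKa : ∀ i : ι, (K ∩ FreeGroup.of i • K).Nonempty) (z : ι × Bool) :
    ∃ P P' : K, FreeGroup.mk [z] • (P' : St.Tb) = P := by
  obtain ⟨i, b⟩ := z
  obtain ⟨x, hx, hx'⟩ := hKa i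
  obtain ⟨y, hy, e⟩ := mem_smul_set.1 hx'
  cases b with
  | true => exact ⟨⟨x, hx⟩, ⟨y, hy⟩, e⟩
  | false =>
    refine ⟨⟨y, hy⟩, ⟨x, hx⟩, ?_⟩
    show (FreeGroup.of i)⁻¹ • x = y
    rw [← e, inv_smul_smul]

theorem mem_piece_mul_of_jmap_mem {g : FreeGroup ι} {z : ι × Bool} {p : IA.TK}
    (hp : p ∈ piece IA g) (hj : IA.jmap p ∈ (g * FreeGroup.mk [z]) • K) :
    p ∈ piece IA (g * FreeGroup.mk [z]) := by
  obtain ⟨x, rfl⟩ := mem_piece.1 hp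
  rw [jmap_smul_emb, mul_smul, smul_mem_smul_set_iff] at hj
  obtain ⟨x', hx', e⟩ := mem_smul_set.1 hj
  rw [← emb_eq_of_letter (x' := ⟨x', hx'⟩) e, ← mul_smul]
  exact smul_mem_piece _ _

theorem mem_piece_prefixN {X : InfWord ι} {n : ℕ} {p : IA.TK} (hp : p ∈ piece IA (X.prefixN n))
    (hj : ∀ m ≥ n, IA.jmap p ∈ X.prefixN m • K) {m : ℕ} (hm : n ≤ m) :
    p ∈ piece IA (X.prefixN m) := by
  induction m, hm using Nat.le_induction with
  | base => exact hp
  | succ m hm ih =>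
    rw [X.prefixN_succ]
    exact mem_piece_mul_of_jmap_mem ih (by rw [← X.prefixN_succ]; exact hj _ (by omega))

variable [DecidableEq ι]

/-- Distances in `T_𝒦` are bounded below by lengths of paths. -/
theorem pathLE_dist (hK : IsCompact K) (hKa : ∀ i : ι, (K ∩ FreeGroup.of i • K).Nonempty)
    (u v : FreeGroup ι) (x y : K) :
    PathLE K (u⁻¹ * v).toWord x y (dist (u • IA.emb x) (v • IA.emb y)) := by
  have hl := exists_letter hKa
  let _ := pathPseudoMetric hK hl
  have hdist : ∀ p q : TranslateUnion ι K, dist p q = pathCost K (p.1⁻¹ * q.1) p.2 q.2 :=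
    fun _ _ => rfl
  have hiso : IsIsometricSMul (FreeGroup ι) (TranslateUnion ι K) := ⟨fun g => by
    refine Isometry.of_dist_eq fun p q => ?_
    rw [hdist, hdist]
    show pathCost K ((g * p.1)⁻¹ * (g * q.1)) p.2 q.2 = _
    congr 1; group⟩
  let e' : K → SeparationQuotient (TranslateUnion ι K) := fun x => SeparationQuotient.mk ⟨1, x⟩
  have hmk : ∀ (g : FreeGroup ι) (p : TranslateUnion ι K),
      g • (SeparationQuotient.mk p) = SeparationQuotient.mk (g • p) := fun _ _ => rfl
  have hcost1 : ∀ x y : K, pathCost K (1 : FreeGroup ι) x y = dist x y := fun x y => by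
    refine le_antisymm (pathCost_le (by rw [FreeGroup.toWord_one]; exact le_refl (dist x y))) ?_
    have := pathLE_pathCost hK hl 1 x y
    rw [FreeGroup.toWord_one] at this
    exact this
  obtain ⟨f, ⟨hf₁, hf₂, hf₃⟩, -⟩ := IA.universal (SeparationQuotient (TranslateUnion ι K))
    (fun g => by
      refine Isometry.of_dist_eq fun p q => ?_
      obtain ⟨p, rfl⟩ := SeparationQuotient.surjective_mk p
      obtain ⟨q, rfl⟩ := SeparationQuotient.surjective_mk q
      rw [hmk, hmk, SeparationQuotient.dist_mk, SeparationQuotient.dist_mk, dist_smul])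
    e' (Isometry.of_dist_eq fun x y => by
      rw [SeparationQuotient.dist_mk, hdist]
      simpa using hcost1 x y)
    (fun i x h => by
      rw [hmk, ← dist_eq_zero, SeparationQuotient.dist_mk, hdist]
      refine le_antisymm (pathCost_le ?_) (pathLE_pathCost hK hl _ _ _).nonneg
      show PathLE K (((FreeGroup.of i)⁻¹ * 1)⁻¹ * 1).toWord x _ 0
      have : (((FreeGroup.of i)⁻¹ * 1)⁻¹ * 1).toWord = [(i, true)] := by simp
      rw [this]
      refine ⟨x, ⟨_, h⟩, smul_inv_smul (FreeGroup.of i) _, ?_⟩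
      show dist _ _ ≤ _
      simp)
  have hval : ∀ (g : FreeGroup ι) (x : K),
      f (g • IA.emb x) = SeparationQuotient.mk ⟨g, x⟩ := fun g x => by
    rw [hf₂, hf₃, hmk]
    exact congrArg (fun h => SeparationQuotient.mk (TranslateUnion.mk h x)) (mul_one g)
  have hle : dist (f (u • IA.emb x)) (f (v • IA.emb y)) ≤ _ :=
    dist_le_of_pieces hK hf₁.1 (fun w p hp q hq => by
      obtain ⟨x, rfl⟩ := mem_piece.1 hp
      obtain ⟨y, rfl⟩ := mem_piece.1 hq
      rw [hval, hval, SeparationQuotient.dist_mk, hdist, dist_smul, IA.emb_isom.dist_eq]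
      show pathCost K (w⁻¹ * w) x y ≤ _
      rw [inv_mul_cancel, hcost1]) _ _
  rw [hval, hval, SeparationQuotient.dist_mk, hdist] at hle
  exact (pathLE_pathCost hK hl _ _ _).mono hle

/-- The set of translates of `K` containing a given point is connected. -/
theorem mem_piece_gprefix (hK : IsCompact K) (hKa : ∀ i : ι, (K ∩ FreeGroup.of i • K).Nonempty)
    {g h : FreeGroup ι} {p : IA.TK} (hg : p ∈ piece IA g) (hh : p ∈ piece IA h) (n : ℕ) :
    p ∈ piece IA (g * gprefix (g⁻¹ * h) n) := by
  obtain ⟨x, rfl⟩ := mem_piece.1 hg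
  obtain ⟨y, e⟩ := mem_piece.1 hh
  have := pathLE_dist hK hKa g h x y (IA := IA)
  rw [e, dist_self] at this
  exact smul_mem_piece_iff.2 (this.emb_eq n)

end Assoc

/-! ### Limits of orbits at the boundary of the free group -/

section Boundary

variable {ι : Type} {St : TreeSetup ι}

theorem mapClusterPt_cofinite (hT : St.Tsub.Nontrivial) {P z : St.Tb} (hP : P ∈ St.Tsub)
    (hz : z ∈ St.Tsub) : MapClusterPt z cofinite fun g : FreeGroup ι => g • P := by
  rw [mapClusterPt_iff_frequently]
  intro s hs hfin
  have hfin : {g : FreeGroup ι | g • P ∈ s}.Finite := by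
    simpa only [eventually_cofinite, not_not] using hfin
  obtain ⟨U, hUs, hU, hzU⟩ := mem_nhds_iff.1 hs
  set A := (fun g : FreeGroup ι => g • P) '' {g | g • P ∈ s}
  have hA : A.Finite := hfin.image _
  have hV : IsOpen (U \ (A \ {z})) := hU.sdiff (hA.subset sdiff_subset).isClosed
  obtain ⟨ε, hε, hball⟩ := Metric.isOpen_iff.1 hV z ⟨hzU, fun h => h.2 rfl⟩
  obtain ⟨z', hz', hne, hd⟩ := exists_near_ne hT hz hε
  have hW : IsOpen ((U \ (A \ {z})) \ {z}) := hV.sdiff isClosed_singleton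
  obtain ⟨δ, hδ, hball'⟩ := Metric.isOpen_iff.1 hW z' ⟨hball (by rwa [Metric.mem_ball'] ), hne⟩
  obtain ⟨g, hg⟩ := exists_smul_near hP hz' hδ
  obtain ⟨⟨h₁, h₂⟩, h₃⟩ := hball' hg
  exact h₂ ⟨⟨g, hUs h₁, rfl⟩, h₃⟩

variable [DecidableEq ι]

theorem TendstoBoundary.tendsto_cofinite {u : ℕ → FreeGroup ι} {X : InfWord ι}
    (h : TendstoBoundary u X) : Tendsto u atTop cofinite := by
  intro s hs
  have hs : sᶜ.Finite := hs
  obtain ⟨n, hn⟩ := (hs.image fun g => g.toWord.length).bddAbove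
  refine (h.length_ge (n + 1)).mono fun k hk => ?_
  by_contra hks
  exact absurd (hn (mem_image_of_mem _ hks)) (by omega)

variable [Finite ι]

theorem finite_length_le (n : ℕ) : {g : FreeGroup ι | g.toWord.length ≤ n}.Finite :=
  (List.finite_length_le (ι × Bool) n).preimage FreeGroup.toWord_injective.injOn

theorem exists_prefix_of_ultrafilter (F : Ultrafilter (FreeGroup ι))
    (hF : (F : Filter (FreeGroup ι)) ≤ cofinite) :
    ∃ X : InfWord ι, ∀ k, ∀ᶠ g : FreeGroup ι in F, g.toWord.take k = (X.prefixN k).toWord := by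
  have hlen : ∀ n, ∀ᶠ g : FreeGroup ι in F, n < g.toWord.length := fun n => hF <| by
    refine eventually_cofinite.2 ?_
    simpa only [not_lt] using finite_length_le n
  have hlet : ∀ n : ℕ, ∃ a, ∀ᶠ g : FreeGroup ι in F, g.toWord[n]? = some a := fun n => by
    obtain ⟨o, ho⟩ := (Ultrafilter.eventually_exists_iff (f := F)
      (P := fun (o : Option (ι × Bool)) (g : FreeGroup ι) => g.toWord[n]? = o)).1
      (Eventually.of_forall fun g : FreeGroup ι => ⟨g.toWord[n]?, rfl⟩)
    obtain ⟨g, h₁, h₂⟩ := (ho.and (hlen n)).exists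
    rw [List.getElem?_eq_getElem h₂] at h₁
    exact ⟨_, by rw [h₁]; exact ho⟩
  choose a ha using hlet
  let X : InfWord ι := ⟨a, fun n => by
    obtain ⟨g, h₁, h₂⟩ := ((ha n).and (ha (n + 1))).exists
    obtain ⟨h₁', h₁⟩ := List.getElem?_eq_some_iff.1 h₁
    obtain ⟨h₂', h₂⟩ := List.getElem?_eq_some_iff.1 h₂
    rw [not_lettersInv_iff, ← h₁, ← h₂]
    exact List.isChain_iff_getElem.1 (FreeGroup.isReduced_toWord (x := g)) n h₂'⟩
  refine ⟨X, fun k => ?_⟩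
  filter_upwards [(eventually_all_finset (Finset.range k)).2 fun n _ => ha n] with g hg
  rw [X.toWord_prefixN]
  refine List.ext_getElem? fun n => ?_
  rw [List.getElem?_take, List.getElem?_ofFn]
  split_ifs with h
  · exact hg n (Finset.mem_range.2 h)
  · rfl

theorem exists_tendstoBoundary (l : Filter (FreeGroup ι)) [l.IsCountablyGenerated]
    [(l ⊓ cofinite).NeBot] :
    ∃ (X : InfWord ι) (u : ℕ → FreeGroup ι), TendstoBoundary u X ∧ Tendsto u atTop l := by
  obtain ⟨X, hX⟩ := exists_prefix_of_ultrafilter (Ultrafilter.of (l ⊓ cofinite))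
    ((Ultrafilter.of_le _).trans inf_le_right)
  obtain ⟨B, hB⟩ := l.exists_antitone_basis
  have : ∀ n, ∃ g, g.toWord.take n = (X.prefixN n).toWord ∧ g ∈ B n := fun n =>
    ((hX n).and (((Ultrafilter.of_le _).trans inf_le_left) (hB.mem n))).exists
  choose u hu hu' using this
  refine ⟨X, u, tendstoBoundary_iff.2 fun k => ?_, hB.tendsto hu'⟩
  filter_upwards [eventually_ge_atTop k] with n hn
  rw [← X.take_toWord_prefixN hn, ← hu n, List.take_take, min_eq_left hn]


theorem exists_tendstoBoundary_of_mapClusterPt {C : Set (FreeGroup ι)} {P z : St.Tb}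
    (h : MapClusterPt z (cofinite ⊓ 𝓟 C) fun g : FreeGroup ι => g • P) :
    ∃ (X : InfWord ι) (u : ℕ → FreeGroup ι), TendstoBoundary u X ∧ (∀ n, u n ∈ C) ∧
      Tendsto (fun n => u n • P) atTop (𝓝 z) := by
  rw [mapClusterPt_def, ClusterPt, ← Filter.push_pull', map_neBot_iff] at h
  have : (comap (fun g : FreeGroup ι => g • P) (𝓝 z) ⊓ 𝓟 C ⊓ cofinite).NeBot := by
    rwa [inf_assoc, inf_comm (𝓟 C)]
  obtain ⟨X, u, hu, hl⟩ := exists_tendstoBoundary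
    (comap (fun g : FreeGroup ι => g • P) (𝓝 z) ⊓ 𝓟 C)
  rw [tendsto_inf, tendsto_comap_iff, tendsto_principal] at hl
  obtain ⟨n₀, hn₀⟩ := eventually_atTop.1 hl.2
  exact ⟨X, fun n => u (n + n₀), fun k => (tendsto_add_atTop_nat n₀).eventually (hu k),
    fun n => hn₀ _ (by omega), hl.1.comp (tendsto_add_atTop_nat n₀)⟩

/-- A set of elements of the free group containing all reduced words with a given prefix. -/
def HasCylinder (C : Set (FreeGroup ι)) : Prop :=
  ∃ w : FreeGroup ι, ∀ g, (w * g).toWord = w.toWord ++ g.toWord → w * g ∈ C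

theorem HasCylinder.exists_mapClusterPt {C : Set (FreeGroup ι)} (hC : HasCylinder C)
    (hι : Nontrivial ι) (hT : St.Tsub.Nontrivial) {P : St.Tb} (hP : P ∈ St.Tsub) :
    ∃ z ∈ St.Tsub, MapClusterPt z (cofinite ⊓ 𝓟 C) fun g : FreeGroup ι => g • P := by
  obtain ⟨w, hw⟩ := hC
  have h := mapClusterPt_cofinite hT hP hP
  rw [← inf_top_eq (a := cofinite), ← principal_univ] at h
  obtain ⟨X, u, hu, -, hz⟩ := exists_tendstoBoundary_of_mapClusterPt h
  have key : ∀ (X : InfWord ι) (v : ℕ → FreeGroup ι), TendstoBoundary v X → ∀ z ∈ St.Tsub,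
      Tendsto (fun n => v n • P) atTop (𝓝 z) →
      (∀ a ∈ w.toWord.getLast?, ¬ LettersInv a (X.letter 0)) →
      ∃ z ∈ St.Tsub, MapClusterPt z (cofinite ⊓ 𝓟 C) fun g : FreeGroup ι => g • P := by
    intro X v hv z hzT hz ha
    refine ⟨w • z, St.invariant w z hzT, ?_⟩
    have h₁ : Tendsto (fun n => w * v n) atTop (cofinite ⊓ 𝓟 C) := by
      refine tendsto_inf.2 ⟨(mul_right_injective w).tendsto_cofinite.comp hv.tendsto_cofinite,
        tendsto_principal.2 ?_⟩
      filter_upwards [hv 1, hv.length_ge 1] with n hn hl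
      refine hw _ (toWord_mul_of_isReduced (isReduced_append FreeGroup.isReduced_toWord
        FreeGroup.isReduced_toWord fun a ha' b hb => ?_))
      rcases hv : (v n).toWord with _ | ⟨b', L⟩
      · rw [hv] at hl; simp at hl
      · rw [hv] at hn hb
        simp only [List.take_succ_cons, List.take_zero, List.ofFn_succ, List.ofFn_zero,
          List.cons.injEq, and_true] at hn
        simp only [List.head?_cons, Option.mem_some] at hb
        rw [← hb, hn]
        exact ha a ha'
    refine MapClusterPt.of_comp h₁ (Tendsto.mapClusterPt ?_)
    simp only [Function.comp_def, mul_smul]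
    exact hz.const_smul w
  by_cases ha : ∀ a ∈ w.toWord.getLast?, ¬ LettersInv a (X.letter 0)
  · exact key X u hu P hP hz ha
  · push Not at ha
    obtain ⟨a, ha, hinv⟩ := ha
    obtain ⟨i, hi⟩ := exists_ne a.1
    have hX : ¬ LettersInv (i, true) (X.letter 0) := fun h => hi (h.1.trans hinv.1.symm)
    refine key _ _ (hu.cons (i, true) hX) _ (St.invariant (FreeGroup.mk [(i, true)]) P hP) ?_ ?_
    · simp only [mul_smul]
      exact hz.const_smul _
    · intro a' ha' h'
      rw [Option.mem_unique ha' ha] at h'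
      exact hi h'.1.symm

theorem exists_connecting (hι : Nontrivial ι) (hT : St.Tsub.Nontrivial) {C : Set (FreeGroup ι)}
    (hC : HasCylinder C) (hC' : HasCylinder Cᶜ) :
    ∃ (z : St.Tb) (X Y : InfWord ι) (u v : ℕ → FreeGroup ι), TendstoBoundary u X ∧
      TendstoBoundary v Y ∧ (∀ n, u n ∈ C) ∧ (∀ n, v n ∉ C) ∧ QRel St X z ∧ QRel St Y z := by
  obtain ⟨P, hP⟩ := St.nonempty
  let f := fun g : FreeGroup ι => g • P
  have hcl : ∀ C : Set (FreeGroup ι), IsClosed {z | MapClusterPt z (cofinite ⊓ 𝓟 C) f} :=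
    fun C => isClosed_setOfPred_clusterPt
  obtain ⟨z, -, h₁, h₂⟩ := isPreconnected_closed_iff.1
    (isPreconnected_of_isSubtree St.sub_subtree) _ _ (hcl C) (hcl Cᶜ) (fun z hz => by
      have h := mapClusterPt_cofinite hT hP hz
      rw [← inf_top_eq (a := cofinite), ← principal_univ, ← union_compl_self C, ← sup_principal,
        inf_sup_left, mapClusterPt_def, Filter.map_sup, clusterPt_sup] at h
      exact h)
    (hC.exists_mapClusterPt hι hT hP) (hC'.exists_mapClusterPt hι hT hP)
  obtain ⟨X, u, hu, huC, huz⟩ := exists_tendstoBoundary_of_mapClusterPt h₁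
  obtain ⟨Y, v, hv, hvC, hvz⟩ := exists_tendstoBoundary_of_mapClusterPt h₂
  exact ⟨z, X, Y, u, v, hu, hv, huC, hvC, ⟨P, hP, u, hu, huz⟩, ⟨P, hP, v, hv, hvz⟩⟩

end Boundary

/-! ### The set of points of `T_𝒦` lying in infinitely many translates of `K` -/

section Core

variable {ι : Type} {St : TreeSetup ι} {K : Set St.Tb} {IA : InducedAssoc St K}

variable (IA) in
/-- The set of points of `T_𝒦` lying in infinitely many translates of `K`. -/
def core : Set IA.TK := {p | {g | p ∈ piece IA g}.Infinite}

theorem smul_mem_core {p : IA.TK} (hp : p ∈ core IA) (g : FreeGroup ι) : g • p ∈ core IA := by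
  refine ((infinite_image_iff (mul_right_injective g).injOn).2 hp).mono ?_
  rintro _ ⟨h, hh, rfl⟩
  exact smul_mem_piece_iff.2 hh

variable [DecidableEq ι]

/-- Each leaf of the dual lamination in the unit cylinder is carried by the system of isometries:
the translates of `K` by the prefixes of both of its halves have a common point. -/
def LeavesCarried (St : TreeSetup ι) (K : Set St.Tb) : Prop :=
  ∀ (X Y : InfWord ι) (Q : St.Tb), X.letter 0 ≠ Y.letter 0 → QRel St X Q → QRel St Y Q →
    ∃ R, ∀ n, R ∈ X.prefixN n • K ∧ R ∈ Y.prefixN n • K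

theorem QRel.shift {X : InfWord ι} {z : St.Tb} (h : QRel St X z) (k : ℕ) :
    QRel St (X.shift k) ((X.prefixN k)⁻¹ • z) := by
  obtain ⟨P, hP, u, hu, hz⟩ := h
  refine ⟨P, hP, _, hu.shift k, ?_⟩
  simp only [mul_smul]
  exact hz.const_smul _

theorem LeavesCarried.exists_common (h : LeavesCarried St K) {X Y : InfWord ι} (hXY : X ≠ Y)
    {z : St.Tb} (hX : QRel St X z) (hY : QRel St Y z) :
    ∃ (n₀ : ℕ) (s : IA.TK), ∀ n ≥ n₀, s ∈ piece IA (X.prefixN n) ∧ s ∈ piece IA (Y.prefixN n) := by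
  obtain ⟨k, hk, hne⟩ := InfWord.exists_first_ne hXY
  obtain ⟨R, hR⟩ := h _ _ _ hne (hX.shift k) (hk ▸ hY.shift k)
  obtain ⟨s, hs, rfl⟩ := exists_mem_piece_jmap (IA := IA) (hR 0).1
  refine ⟨k, X.prefixN k • s, fun n hn => ?_⟩
  obtain ⟨m, rfl⟩ := Nat.exists_eq_add_of_le hn
  rw [X.prefixN_add, Y.prefixN_add, ← hk, smul_mem_piece_iff, smul_mem_piece_iff]
  refine ⟨mem_piece_prefixN (n := 0) hs (fun m _ => (hR m).1) (Nat.zero_le m),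
    mem_piece_prefixN (n := 0) ?_ (fun m _ => (hR m).2) (Nat.zero_le m)⟩
  rwa [InfWord.prefixN_zero] at hs ⊢

/-- Every point in almost all translates of `K` by the prefixes of `X` represents `X`. -/
theorem qRel_of_forall_mem (hK : IsCompact K) {X : InfWord ι} {z : St.Tb} {n₀ : ℕ}
    (h : ∀ n ≥ n₀, z ∈ X.prefixN n • K) : QRel St X z := by
  obtain ⟨P, hP⟩ := St.nonempty
  obtain ⟨y, -, φ, hφ, hy⟩ := hK.tendsto_subseq (x := fun n => (X.prefixN (n + n₀))⁻¹ • z)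
    fun n => mem_smul_set_iff_inv_smul_mem.1 (h _ (by omega))
  have hε : ∀ n : ℕ, (0 : ℝ) < 1 / (n + 1) := fun n => Nat.one_div_pos_of_nat
  choose s hs using fun n => exists_smul_near' (Q := y) hP (hε n)
  have hm : ∀ n, ∃ m, n + (s n).toWord.length ≤ φ m ∧
      dist ((X.prefixN (φ m + n₀))⁻¹ • z) y < 1 / (n + 1) := fun n =>
    (((hφ.tendsto_atTop.eventually_ge_atTop (n + (s n).toWord.length))).and
      (Metric.tendsto_nhds.1 hy _ (hε n))).exists
  choose m hm₁ hm₂ using hm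
  refine ⟨P, hP, fun n => X.prefixN (φ (m n) + n₀) * s n, tendstoBoundary_iff.2 fun k => ?_, ?_⟩
  · filter_upwards [eventually_ge_atTop k] with n hn
    have := hm₁ n
    rw [take_toWord_mul (by rw [InfWord.length_prefixN]; omega), X.take_toWord_prefixN (by omega)]
  · rw [tendsto_iff_dist_tendsto_zero]
    have hlim : Tendsto (fun n : ℕ => (1 / (n + 1) + 1 / (n + 1) : ℝ)) atTop (𝓝 0) := by
      simpa using tendsto_one_div_add_atTop_nhds_zero_nat.add
        (tendsto_one_div_add_atTop_nhds_zero_nat (𝕜 := ℝ))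
    refine squeeze_zero (fun _ => dist_nonneg) (fun n => ?_) hlim
    rw [mul_smul, dist_comm, ← dist_smul_inv, dist_comm]
    exact (dist_triangle_right _ _ y).trans (add_le_add (hs n).le (hm₂ n).le)

theorem mk_take_eq_mul_gprefix (g u : FreeGroup ι) {n : ℕ} (h : g.toWord.length ≤ n) :
    ∃ k, FreeGroup.mk (u.toWord.take n) = g * gprefix (g⁻¹ * u) k := by
  obtain ⟨p, c, q, h₁, h₂, h₃⟩ := exists_cancel g⁻¹ u
  have hl : (FreeGroup.invRev c).length ≤ n := by
    have := congrArg List.length h₁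
    rw [FreeGroup.toWord_inv, FreeGroup.invRev_length, List.length_append] at this
    rw [FreeGroup.invRev_length]; omega
  refine ⟨p.length + (n - (FreeGroup.invRev c).length), ?_⟩
  rw [gprefix, h₃, h₂, List.take_append, List.take_of_length_le hl, List.take_length_add_append,
    mk_append, mk_append, ← FreeGroup.inv_mk, ← mul_assoc]
  congr 1
  have : g⁻¹ = FreeGroup.mk p * FreeGroup.mk c := eq_mk_mul_mk h₁
  rw [← inv_inv g, this]; group

theorem mem_core_of_prefixN {X : InfWord ι} {p : IA.TK} {n₀ : ℕ}
    (h : ∀ n ≥ n₀, p ∈ piece IA (X.prefixN n)) : p ∈ core IA := by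
  refine (infinite_of_injective_forall_mem (f := fun n => X.prefixN (n + n₀)) (fun m n hmn => ?_)
    fun n => h _ (by omega))
  have := congrArg (fun g => g.toWord.length) hmn
  simpa using this

theorem mem_iff_mul_mem {C : Set (FreeGroup ι)} {n₀ : ℕ}
    (hC : ∀ (g : FreeGroup ι) (a : ι × Bool), n₀ < g.toWord.length →
      n₀ < (g * FreeGroup.mk [a]).toWord.length → (g ∈ C ↔ g * FreeGroup.mk [a] ∈ C))
    {w : FreeGroup ι} (hw : n₀ < w.toWord.length) {g : FreeGroup ι}
    (hg : (w * g).toWord = w.toWord ++ g.toWord) : w ∈ C ↔ w * g ∈ C := by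
  have hred : FreeGroup.IsReduced (w.toWord ++ g.toWord) := hg ▸ FreeGroup.isReduced_toWord
  rw [← FreeGroup.mk_toWord (x := g)]
  generalize g.toWord = L at hred
  induction L using List.reverseRecOn with
  | nil => rw [← FreeGroup.one_eq_mk, mul_one]
  | append_singleton L a ih =>
    have hred' : FreeGroup.IsReduced (w.toWord ++ L) := hred.infix ⟨[], [a], by simp⟩
    have hlen : ∀ L, FreeGroup.IsReduced (w.toWord ++ L) →
        n₀ < (w * FreeGroup.mk L).toWord.length := fun L hL => by
      have : w * FreeGroup.mk L = FreeGroup.mk (w.toWord ++ L) := by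
        rw [mk_append, FreeGroup.mk_toWord]
      rw [this, toWord_mk_of_isReduced hL, List.length_append]; omega
    rw [mk_append, ← mul_assoc]
    refine (ih hred').trans (hC _ a (hlen L hred') ?_)
    rw [mul_assoc, ← mk_append]
    exact hlen _ hred

variable [Finite ι]

theorem exists_prefixN_of_mem_core (hK : IsCompact K)
    (hKa : ∀ i : ι, (K ∩ FreeGroup.of i • K).Nonempty) {p : IA.TK} (hp : p ∈ core IA) :
    ∃ (X : InfWord ι) (n₀ : ℕ), ∀ n ≥ n₀, p ∈ piece IA (X.prefixN n) := by
  have : (𝓟 {g | p ∈ piece IA g} ⊓ cofinite).NeBot := by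
    rw [inf_comm]; exact cofinite_inf_principal_neBot_iff.2 hp
  obtain ⟨X, u, hu, hl⟩ := exists_tendstoBoundary (𝓟 {g | p ∈ piece IA g})
  obtain ⟨g, hg⟩ := exists_mem_piece p
  refine ⟨X, g.toWord.length, fun n hn => ?_⟩
  obtain ⟨m, h₁, h₂⟩ := ((tendstoBoundary_iff.1 hu n).and (tendsto_principal.1 hl)).exists
  obtain ⟨k, hk⟩ := mk_take_eq_mul_gprefix g (u m) hn
  rw [h₁, FreeGroup.mk_toWord] at hk
  rw [hk]
  exact mem_piece_gprefix hK hKa hg h₂ k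

theorem injOn_jmap_core (hK : IsCompact K) (hKa : ∀ i : ι, (K ∩ FreeGroup.of i • K).Nonempty)
    (h : LeavesCarried St K) : InjOn IA.jmap (core IA) := by
  intro p hp q hq hpq
  obtain ⟨X, n₁, hX⟩ := exists_prefixN_of_mem_core hK hKa hp
  obtain ⟨Y, n₂, hY⟩ := exists_prefixN_of_mem_core hK hKa hq
  have hzX : ∀ n ≥ n₁, IA.jmap p ∈ X.prefixN n • K := fun n hn => jmap_mem (hX n hn)
  have hzY : ∀ n ≥ n₂, IA.jmap p ∈ Y.prefixN n • K := fun n hn => hpq ▸ jmap_mem (hY n hn)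
  by_cases hXY : X = Y
  · subst hXY
    exact eq_of_jmap_eq (hX (max n₁ n₂) (le_max_left _ _)) (hY _ (le_max_right _ _)) hpq
  · obtain ⟨n₃, s, hs⟩ := h.exists_common (IA := IA) hXY (qRel_of_forall_mem hK hzX)
      (qRel_of_forall_mem hK hzY)
    have hj : IA.jmap s = IA.jmap p := eq_of_forall_mem_prefixN_smul hK (X := X) (n₀ := max n₁ n₃)
      (fun n hn => jmap_mem (hs n (le_of_max_le_right hn)).1)
      fun n hn => hzX n (le_of_max_le_left hn)
    rw [← eq_of_jmap_eq (hs (max n₁ n₃) (le_max_right _ _)).1 (hX _ (le_max_left _ _)) hj]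
    exact eq_of_jmap_eq (hs (max n₂ n₃) (le_max_right _ _)).2 (hY _ (le_max_left _ _))
      (hj.trans hpq)

theorem core_nonempty [Nontrivial ι] (hT : St.Tsub.Nontrivial) (h : LeavesCarried St K) :
    (core IA).Nonempty := by
  obtain ⟨i, j, hij⟩ := exists_pair_ne ι
  have hcyl : ∀ (i : ι) (g : FreeGroup ι),
      (FreeGroup.of i * g).toWord = (FreeGroup.of i).toWord ++ g.toWord →
      (FreeGroup.of i * g).toWord.take 1 = [(i, true)] := fun i g hg => by
    rw [hg, FreeGroup.toWord_of]; rfl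
  obtain ⟨z, X, Y, u, v, hu, hv, huC, hvC, hX, hY⟩ := exists_connecting (St := St)
    (C := {g | g.toWord.take 1 = [(i, true)]}) ‹_› hT ⟨FreeGroup.of i, hcyl i⟩
    ⟨FreeGroup.of j, fun g hg h' => hij (by
      have h' := (hcyl j g hg).symm.trans h'
      simpa using h'.symm)⟩
  have hXY : X ≠ Y := by
    rintro rfl
    obtain ⟨n, h₁, h₂⟩ := ((tendstoBoundary_iff.1 hu 1).and (tendstoBoundary_iff.1 hv 1)).exists
    exact hvC n (h₂.trans (h₁.symm.trans (huC n)))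
  obtain ⟨n₀, s, hs⟩ := h.exists_common (IA := IA) hXY hX hY
  exact ⟨s, mem_core_of_prefixN fun n hn => (hs n hn).1⟩

theorem isSubtree_core [Nontrivial ι]
    (hKa : ∀ i : ι, (K ∩ FreeGroup.of i • K).Nonempty) (hT : St.Tsub.Nontrivial)
    (h : LeavesCarried St K) : IsSubtree (core IA) := by
  intro p hp q hq r hr
  by_contra hr'
  have hfin : {g | r ∈ piece IA g}.Finite := not_infinite.1 hr'
  have hrp : r ≠ p := fun e => hr' (e ▸ hp)
  have hrq : r ≠ q := fun e => hr' (e ▸ hq)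
  obtain ⟨n₀, hn₀⟩ := (hfin.image fun g => g.toWord.length).bddAbove
  have hfar : ∀ g : FreeGroup ι, n₀ < g.toWord.length → r ∉ piece IA g := fun g hg hrg =>
    (hn₀ (mem_image_of_mem _ hrg)).not_gt hg
  set C : Set (FreeGroup ι) := {g | ∀ y ∈ piece IA g, r ∉ seg p y} with hCdef
  have hmem : ∀ g : FreeGroup ι, n₀ < g.toWord.length → ∀ y ∈ piece IA g,
      (g ∈ C ↔ r ∉ seg p y) := fun g hg y hy => by
    refine ⟨fun h => h y hy, fun h y' hy' hry' => ?_⟩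
    rcases mem_seg_or y hry' with h' | h'
    · exact h h'
    · exact hfar g hg (isSubtree_piece g y hy y' hy' h')
  have hstep : ∀ (g : FreeGroup ι) (a : ι × Bool), n₀ < g.toWord.length →
      n₀ < (g * FreeGroup.mk [a]).toWord.length → (g ∈ C ↔ g * FreeGroup.mk [a] ∈ C) := by
    intro g a hg hga
    obtain ⟨P, P', e⟩ := exists_letter hKa a
    have h₁ := smul_mem_piece (IA := IA) g P
    have h₂ := smul_mem_piece (IA := IA) (g * FreeGroup.mk [a]) P'
    rw [mul_smul, emb_eq_of_letter e] at h₂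
    rw [hmem g hg _ h₁, hmem _ hga _ h₂]
  have hlarge : ∀ {s : IA.TK}, s ∈ core IA → ∃ w, s ∈ piece IA w ∧ n₀ < w.toWord.length := by
    intro s hs
    by_contra! hcon
    exact hs ((finite_length_le n₀).subset hcon)
  obtain ⟨w, hpw, hw⟩ := hlarge hp
  obtain ⟨w', hqw, hw'⟩ := hlarge hq
  have hwC : w ∈ C := (hmem w hw p hpw).2 (by rwa [seg_self])
  have hwC' : w' ∉ C := fun h => (hmem w' hw' q hqw).1 h hr
  obtain ⟨z, X, Y, u, v, hu, hv, huC, hvC, hX, hY⟩ := exists_connecting (St := St) (C := C)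
    ‹_› hT ⟨w, fun g hg => (mem_iff_mul_mem hstep hw hg).1 hwC⟩
    ⟨w', fun g hg h => hwC' ((mem_iff_mul_mem hstep hw' hg).2 h)⟩
  have hpre : ∀ {X : InfWord ι} {u : ℕ → FreeGroup ι}, TendstoBoundary u X → ∀ m, n₀ < m →
      ∃ n, (X.prefixN m ∈ C ↔ u n ∈ C) := fun {X u} hu m hm => by
    obtain ⟨n, hn⟩ := (tendstoBoundary_iff.1 hu m).exists
    refine ⟨n, ?_⟩
    have e := eq_prefixN_mul hn
    conv_rhs => rw [e]
    refine mem_iff_mul_mem hstep (by simpa using hm) ?_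
    rw [← e, toWord_mk_drop, ← hn, List.take_append_drop]
  have hXC : ∀ m, n₀ < m → X.prefixN m ∈ C := fun m hm => by
    obtain ⟨n, hn⟩ := hpre hu m hm
    exact hn.2 (huC n)
  have hYC : ∀ m, n₀ < m → Y.prefixN m ∉ C := fun m hm => by
    obtain ⟨n, hn⟩ := hpre hv m hm
    exact fun h => hvC n (hn.1 h)
  have hXY : X ≠ Y := by
    rintro rfl
    exact hYC (n₀ + 1) (by omega) (hXC _ (by omega))
  obtain ⟨n₁, s, hs⟩ := h.exists_common (IA := IA) hXY hX hY
  have hlen : ∀ X : InfWord ι, n₀ < (X.prefixN (n₀ + n₁ + 1)).toWord.length := fun X => by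
    rw [InfWord.length_prefixN]; omega
  have h₁ := (hmem _ (hlen X) s (hs _ (by omega)).1).1 (hXC _ (by omega))
  exact hYC _ (by omega) ((hmem _ (hlen Y) s (hs (n₀ + n₁ + 1) (by omega)).2).2 h₁)

theorem dist_jmap_core [Nontrivial ι] (hK : IsCompact K)
    (hKa : ∀ i : ι, (K ∩ FreeGroup.of i • K).Nonempty) (hT : St.Tsub.Nontrivial)
    (h : LeavesCarried St K) {p q : IA.TK} (hp : p ∈ core IA) (hq : q ∈ core IA) :
    dist (IA.jmap p) (IA.jmap q) = dist p q := by
  refine dist_eq_of_local (dist_jmap_le hK)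
    ((injOn_jmap_core hK hKa h).mono (isSubtree_core hKa hT h p hp q hq)) fun c _ => ?_
  filter_upwards [eventually_common_piece hK p q c] with c' ⟨w, h₁, h₂⟩ using
    dist_jmap_of_mem_piece h₁ h₂

end Core

section Minimal

theorem isSubtree_image {T T' : Type*} [MetricSpace T] [IsRTree T] [MetricSpace T'] [IsRTree T']
    {f : T → T'} {A : Set T} (hA : IsSubtree A)
    (hf : ∀ p ∈ A, ∀ q ∈ A, dist (f p) (f q) = dist p q) : IsSubtree (f '' A) := by
  rintro _ ⟨p, hp, rfl⟩ _ ⟨q, hq, rfl⟩ z hz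
  obtain ⟨r, hr, hd⟩ := exists_mem_seg (x := p) (y := q) (t := dist (f p) z) dist_nonneg (by
    rw [← hf p hp q hq, ← hz]; exact le_add_of_nonneg_right dist_nonneg)
  have hrA := hA p hp q hq hr
  refine ⟨r, hrA, (seg_unique ?_ hz ?_)⟩
  · rw [mem_seg, hf p hp r hrA, hf r hrA q hq, hf p hp q hq]; exact hr
  · rw [hf p hp r hrA, hd]

/-- A subtree meets another one whose points all have the same distance to it. -/
theorem inter_nonempty_of_infDist {T : Type*} [MetricSpace T] [IsRTree T] {A B : Set T}
    (hA : IsSubtree A) (hAne : A.Nonempty) (hB : IsSubtree B) (hBne : B.Nontrivial)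
    (h : ∀ b ∈ B, ∀ b' ∈ B, Metric.infDist b A ≤ Metric.infDist b' A) : (A ∩ B).Nonempty := by
  obtain ⟨b₁, h₁, b₂, h₂, hne⟩ := hBne
  have hD := dist_pos.2 hne
  obtain ⟨m, hm, hd⟩ := exists_mem_seg (x := b₁) (y := b₂) (t := dist b₁ b₂ / 2)
    (by positivity) (by linarith)
  have hmB := hB b₁ h₁ b₂ h₂ hm
  have hd' : dist b₂ m = dist b₁ b₂ / 2 := by rw [mem_seg] at hm; rw [dist_comm]; linarith
  have key : ∀ b ∈ B, dist b m = dist b₁ b₂ / 2 → ∃ a ∈ A, m ∉ seg b a := fun b hb hbm => by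
    obtain ⟨a, ha, hlt⟩ := (Metric.infDist_lt_iff hAne (x := b)
      (r := Metric.infDist m A + dist b₁ b₂ / 2)).1 (by linarith [h b hb m hmB])
    refine ⟨a, ha, fun hseg => ?_⟩
    rw [mem_seg] at hseg
    linarith [Metric.infDist_le_dist_of_mem (x := m) ha]
  obtain ⟨a, ha, hma⟩ := key b₁ h₁ hd
  obtain ⟨a', ha', hma'⟩ := key b₂ h₂ hd'
  rcases mem_seg_or a' hm with h' | h'
  · rcases mem_seg_or a h' with h'' | h''
    · exact absurd h'' hma
    · exact ⟨m, hA a ha a' ha' h'', hmB⟩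
  · exact absurd (seg_comm a' b₂ ▸ h') hma'

variable {ι : Type} [DecidableEq ι] [Finite ι] {St : TreeSetup ι} {K : Set St.Tb}
  {IA : InducedAssoc St K}

theorem isometry_minSubtree_of_leavesCarried [Nontrivial ι] (hK : IsCompact K)
    (hKa : ∀ i : ι, (K ∩ FreeGroup.of i • K).Nonempty) (hT : St.Tsub.Nontrivial)
    (h : LeavesCarried St K) :
    (∀ p ∈ minSubtree (FreeGroup ι) IA.TK, ∀ q ∈ minSubtree (FreeGroup ι) IA.TK,
      dist (IA.jmap p) (IA.jmap q) = dist p q) ∧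
    IA.jmap '' minSubtree (FreeGroup ι) IA.TK = St.Tsub := by
  have hd : ∀ p ∈ core IA, ∀ q ∈ core IA, dist (IA.jmap p) (IA.jmap q) = dist p q :=
    fun p hp q hq => dist_jmap_core hK hKa hT h hp hq
  have hBsub := isSubtree_core (IA := IA) hKa hT h
  set B₀ := core IA ∩ IA.jmap ⁻¹' St.Tsub with hB₀
  have hd₀ : ∀ p ∈ B₀, ∀ q ∈ B₀, dist (IA.jmap p) (IA.jmap q) = dist p q :=
    fun p hp q hq => hd p hp.1 q hq.1
  have hsub : IsSubtree B₀ := by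
    intro p hp q hq r hr
    have hrB := hBsub p hp.1 q hq.1 hr
    refine ⟨hrB, St.sub_subtree _ hp.2 _ hq.2 ?_⟩
    rw [mem_seg, hd p hp.1 r hrB, hd r hrB q hq.1, hd p hp.1 q hq.1]; exact hr
  have hinv : ∀ g : FreeGroup ι, ∀ p ∈ B₀, g • p ∈ B₀ := fun g p hp =>
    ⟨smul_mem_core hp.1 g, by
      rw [mem_preimage, IA.jmap_equivariant]; exact St.invariant g _ hp.2⟩
  have hne : B₀.Nonempty := by
    obtain ⟨p, hp⟩ := core_nonempty (IA := IA) hT h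
    obtain ⟨g, hg⟩ := not_fixed hT (IA.jmap p)
    have hgp := smul_mem_core hp g
    rw [← IA.jmap_equivariant] at hg
    have hD := dist_pos.2 (fun e => hg (congrArg IA.jmap e).symm : p ≠ g • p)
    obtain ⟨m, hm, hdm⟩ := exists_mem_seg (x := p) (y := g • p) (t := dist p (g • p) / 2)
      (by positivity) (by linarith)
    have hmB := hBsub _ hp _ hgp hm
    have hdm' : dist m (g • p) = dist p (g • p) / 2 := by rw [mem_seg] at hm; linarith
    refine ⟨m, hmB, mem_Tsub_of_mem_seg (x := IA.jmap p) (y := IA.jmap (g • p)) ?_ ?_ ?_⟩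
    · rw [mem_seg, hd _ hp _ hmB, hd _ hmB _ hgp, hd _ hp _ hgp]; exact hm
    · intro e
      have := hd _ hp _ hmB
      rw [e, dist_self] at this; linarith
    · intro e
      have := hd _ hmB _ hgp
      rw [e, dist_self] at this; linarith
  have himage : ∀ A ⊆ B₀, A.Nonempty → IsSubtree A → (∀ g : FreeGroup ι, ∀ x ∈ A, g • x ∈ A) →
      IA.jmap '' A = St.Tsub := fun A hA hAne hAs hAi => by
    refine St.minimal _ ?_ (hAne.image _)
      (isSubtree_image hAs fun p hp q hq => hd₀ p (hA hp) q (hA hq)) ?_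
    · rintro _ ⟨p, hp, rfl⟩; exact (hA hp).2
    · rintro g _ ⟨p, hp, rfl⟩
      exact ⟨g • p, hAi g p hp, IA.jmap_equivariant g p⟩
  have hB₀T := himage B₀ subset_rfl hne hsub hinv
  have hmin : minSubtree (FreeGroup ι) IA.TK = B₀ := by
    refine Subset.antisymm (fun p hp => hp B₀ ⟨hne, hsub, hinv⟩) ?_
    rintro b hb A ⟨hAne, hAs, hAi⟩
    have hBnt : B₀.Nontrivial := by
      rw [← hB₀T] at hT
      exact Set.nontrivial_of_image _ _ hT
    have hinf : ∀ (g : FreeGroup ι) (p : IA.TK), Metric.infDist (g • p) A ≤ Metric.infDist p A :=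
      fun g p => by
        refine (Metric.le_infDist hAne).2 fun a ha => ?_
        rw [← dist_smul g]
        exact Metric.infDist_le_dist_of_mem (hAi g a ha)
    have hmeet : (A ∩ B₀).Nonempty := inter_nonempty_of_infDist hAs hAne hsub hBnt
      fun p hp q hq => by
        refine le_of_forall_pos_le_add fun ε hε => ?_
        obtain ⟨g, hg⟩ := exists_smul_near (P := IA.jmap q) (Q := IA.jmap p) hq.2 hp.2 hε
        rw [← IA.jmap_equivariant, hd₀ _ (hinv g q hq) _ hp, dist_comm] at hg
        calc Metric.infDist p A ≤ Metric.infDist (g • q) A + dist p (g • q) :=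
              Metric.infDist_le_infDist_add_dist
          _ ≤ _ := add_le_add (hinf g q) hg.le
    have hT' := himage (A ∩ B₀) inter_subset_right hmeet (isSubtree_inter hAs hsub)
      fun g x hx => ⟨hAi g x hx.1, hinv g x hx.2⟩
    obtain ⟨a, ha, e⟩ : IA.jmap b ∈ IA.jmap '' (A ∩ B₀) := hT' ▸ hb.2
    have := hd₀ a ha.2 b hb
    rw [e, dist_self, eq_comm, dist_eq_zero] at this
    exact this ▸ ha.1
  rw [hmin]
  exact ⟨hd₀, hB₀T⟩

end Minimal

/-! ### The limit set, the dual language, and leaves of the dual lamination -/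

section Leaves

variable {ι : Type} {St : TreeSetup ι} {K : Set St.Tb}

theorem translationLengthOn_le {g : FreeGroup ι} {z : St.Tb} (hz : z ∈ St.Tsub) :
    translationLengthOn St.Tsub g ≤ dist z (g • z) :=
  ciInf_le ⟨0, by rintro _ ⟨x, rfl⟩; exact dist_nonneg⟩ (⟨z, hz⟩ : St.Tsub)

variable [DecidableEq ι]

theorem InfWord.toWord_inv_mul_prefixN {X Y : InfWord ι} (h : X.letter 0 ≠ Y.letter 0) (m n : ℕ) :
    ((X.prefixN m)⁻¹ * Y.prefixN n).toWord =
      FreeGroup.invRev (X.prefixN m).toWord ++ (Y.prefixN n).toWord := by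
  refine toWord_inv_mul ?_
  rw [X.toWord_prefixN, Y.toWord_prefixN]
  cases m <;> cases n <;> simp [Ne.symm h]

theorem TendstoBoundary.eventually_toWord_inv_mul {X Y : InfWord ι} {u v : ℕ → FreeGroup ι}
    (hu : TendstoBoundary u X) (hv : TendstoBoundary v Y) (h : X.letter 0 ≠ Y.letter 0) :
    ∀ᶠ n in atTop, ((u n)⁻¹ * v n).toWord = FreeGroup.invRev (u n).toWord ++ (v n).toWord := by
  filter_upwards [hu 1, hv 1] with n h₁ h₂
  refine toWord_inv_mul fun a ha hb => h ?_
  rw [List.ofFn_succ, List.ofFn_zero] at h₁ h₂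
  rcases hu : (u n).toWord with _ | ⟨b, L⟩
  · simp [hu] at h₁
  rcases hv : (v n).toWord with _ | ⟨b', L'⟩
  · simp [hv] at h₂
  simp_all

theorem QRel.cons {X : InfWord ι} {Q : St.Tb} (h : QRel St X Q) (a : ι × Bool)
    (ha : ¬ LettersInv a (X.letter 0)) : QRel St (X.cons a ha) (FreeGroup.mk [a] • Q) := by
  obtain ⟨P, hP, u, hu, hQ⟩ := h
  refine ⟨P, hP, _, hu.cons a ha, ?_⟩
  simp only [mul_smul]
  exact hQ.const_smul _

theorem mem_prefixN_smul_of_limitSet_subset (h : limitSet St ⊆ K) {X Y : InfWord ι} {Q : St.Tb}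
    (hXY : X.letter 0 ≠ Y.letter 0) (hX : QRel St X Q) (hY : QRel St Y Q) (n : ℕ) :
    Q ∈ X.prefixN n • K := by
  induction n generalizing X Y Q with
  | zero =>
    rw [InfWord.prefixN_zero, one_smul]
    exact h ⟨X, Y, hXY, hX, hY⟩
  | succ n ih =>
    have ha : ¬ LettersInv (linv (X.letter 0)) (Y.letter 0) := by
      rw [lettersInv_iff, linv_linv]; exact hXY.symm
    have hY' := hY.cons _ ha
    rw [mk_linv, ← InfWord.prefixN_one] at hY'
    rw [add_comm, InfWord.prefixN_add, mul_smul, mem_smul_set_iff_inv_smul_mem]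
    refine ih (fun e => X.reduced 0 ?_) (hX.shift 1) hY'
    exact lettersInv_iff.2 e

theorem leavesCarried_of_limitSet_subset (h : limitSet St ⊆ K) : LeavesCarried St K :=
  fun _ _ Q hXY hX hY => ⟨Q, fun n => ⟨mem_prefixN_smul_of_limitSet_subset h hXY hX hY n,
    mem_prefixN_smul_of_limitSet_subset h hXY.symm hY hX n⟩⟩

/-- A conjugate of a word `y R x⁻¹` is cyclically reduced with prefix `x⁻¹ y`. -/
theorem isCyclicallyReduced_of_conj {x y c : FreeGroup ι} {R : List (ι × Bool)}
    (hxy : (x⁻¹ * y).toWord = x⁻¹.toWord ++ y.toWord) (hx : x ≠ 1) (hy : y ≠ 1)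
    (hR : R ≠ []) (hc : c.toWord = y.toWord ++ R ++ x⁻¹.toWord) :
    (x⁻¹ * y * FreeGroup.mk R).toWord = (x⁻¹ * y).toWord ++ (FreeGroup.mk R).toWord ∧
      IsCyclicallyReduced (x⁻¹ * y * FreeGroup.mk R) ∧
      x⁻¹ * y * FreeGroup.mk R = x⁻¹ * c * x := by
  have hred : FreeGroup.IsReduced (y.toWord ++ R ++ x⁻¹.toWord) := hc ▸ FreeGroup.isReduced_toWord
  have hRw : (FreeGroup.mk R).toWord = R :=
    toWord_mk_of_isReduced (hred.infix ⟨y.toWord, x⁻¹.toWord, rfl⟩)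
  have hw : (x⁻¹ * y * FreeGroup.mk R).toWord = (x⁻¹ * y).toWord ++ (FreeGroup.mk R).toWord := by
    refine toWord_mul_of_isReduced ?_
    rw [hxy, hRw]
    exact (hxy ▸ FreeGroup.isReduced_toWord (x := x⁻¹ * y)).append_overlap
      (hred.infix ⟨[], x⁻¹.toWord, rfl⟩) (mt FreeGroup.toWord_eq_nil_iff.1 hy)
  refine ⟨hw, ⟨fun e => ?_, fun a ha b hb => ?_⟩, ?_⟩
  · rw [e, hRw, FreeGroup.toWord_one] at hw
    exact hR (List.append_eq_nil_iff.1 hw.symm).2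
  · rw [hw, hxy, hRw] at ha hb
    rw [List.append_assoc, List.head?_append_of_ne_nil _
      (mt FreeGroup.toWord_eq_nil_iff.1 (inv_ne_one.2 hx))] at ha
    rw [List.getLast?_append_of_ne_nil _ hR] at hb
    rw [not_lettersInv_comm, not_lettersInv_iff]
    exact (List.isChain_append.1
      (hred.infix (L₁ := R ++ x⁻¹.toWord) ⟨y.toWord, [], by simp⟩)).2.2 b hb a ha
  · rw [← FreeGroup.mk_toWord (x := c), hc, mk_append, mk_append, FreeGroup.mk_toWord,
      FreeGroup.mk_toWord]
    group

theorem inv_mul_mem_dualLanguageOn (hT : St.Tsub.Nontrivial) {X Y : InfWord ι} {Q : St.Tb}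
    (hXY : X.letter 0 ≠ Y.letter 0) (hX : QRel St X Q) (hY : QRel St Y Q) {m : ℕ} (hm : 1 ≤ m) :
    (X.prefixN m)⁻¹ * Y.prefixN m ∈ dualLanguageOn ι St.Tsub := by
  intro ε hε
  obtain ⟨P, hP, u, hu, hPQ⟩ := hX
  obtain ⟨P', hP', v, hv, hPQ'⟩ := hY
  obtain ⟨g, hg⟩ := exists_smul_near hP hP' (ε := ε / 4) (by positivity)
  obtain ⟨s₁, s₂, hne, hs₁, hs₂⟩ := exists_noncomm hT hP (ε := ε / 4) (by positivity)
  set L := max s₁.toWord.length s₂.toWord.length with hL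
  have hu' := tendstoBoundary_iff.1 hu (m + 6 * L + 1)
  have hv' := tendstoBoundary_iff.1 (hv.mul_right g) (m + 6 * L + 1)
  obtain ⟨n, ⟨h₁, h₂⟩, h₃, h₄⟩ := ((hu'.and hv').and ((Metric.tendsto_nhds.1 hPQ (ε / 4)
    (by positivity)).and (Metric.tendsto_nhds.1 hPQ' (ε / 4) (by positivity)))).exists
  obtain ⟨s, hs, hpre⟩ := exists_short_common_prefix hne (le_max_left _ _) (le_max_right _ _)
    (v n * g)⁻¹ (u n)⁻¹
  rw [← hL] at hpre
  have hsP : dist P (s • P) < ε / 4 := by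
    rcases hs with rfl | rfl | rfl
    · rw [one_smul, dist_self]; positivity
    · exact hs₁
    · exact hs₂
  have hsL : s.toWord.length ≤ L := by
    rcases hs with rfl | rfl | rfl
    · simp
    · exact le_max_left _ _
    · exact le_max_right _ _
  obtain ⟨p, c, q, e₁, e₂, e₃⟩ := exists_cancel (v n * g) (s * (u n)⁻¹)
  have hc : c.length < 4 * L := by
    by_contra! hc
    apply hpre
    rw [FreeGroup.toWord_inv, e₁, e₂, FreeGroup.invRev_append, List.take_append_of_le_length,
      List.take_append_of_le_length] <;> simpa using hc
  have hlen : ∀ {w : FreeGroup ι} {Z : InfWord ι} {k : ℕ}, w.toWord.take k = (Z.prefixN k).toWord →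
      k ≤ w.toWord.length := fun {w Z k} h => by
    have := congrArg List.length h
    rw [List.length_take, InfWord.length_prefixN] at this
    omega
  have h₁' : (u n * s⁻¹).toWord.take (m + 5 * L + 1) = (X.prefixN (m + 5 * L + 1)).toWord := by
    have := hlen h₁
    rw [take_toWord_mul (by rw [FreeGroup.toWord_inv, FreeGroup.invRev_length]; omega),
      ← X.take_toWord_prefixN (show m + 5 * L + 1 ≤ m + 6 * L + 1 by omega), ← h₁, List.take_take,
      min_eq_left (by omega)]
  have e₂' : (u n * s⁻¹).toWord = FreeGroup.invRev q ++ c := by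
    rw [← FreeGroup.invRev_invRev (L₁ := c), ← FreeGroup.invRev_append, ← e₂,
      ← FreeGroup.toWord_inv, mul_inv_rev, inv_inv]
  have hsplit : ∀ {w : FreeGroup ι} {Z : InfWord ι} {k : ℕ} {p c : List (ι × Bool)},
      w.toWord.take k = (Z.prefixN k).toWord → w.toWord = p ++ c → m + 1 + c.length ≤ k →
      ∃ p' ≠ [], p = (Z.prefixN m).toWord ++ p' := fun {w Z k p c} h h' hk => by
    have hk' := hlen h
    have hp : m + 1 ≤ p.length := by
      rw [h', List.length_append] at hk'; omega
    refine ⟨p.drop m, fun e => ?_, ?_⟩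
    · have := congrArg List.length e
      rw [List.length_drop, List.length_nil] at this
      omega
    · rw [← Z.take_toWord_prefixN (show m ≤ k by omega), ← h, h', List.take_take,
        min_eq_left (by omega), List.take_append_of_le_length (by omega), List.take_append_drop]
  obtain ⟨p', hp', rfl⟩ := hsplit h₂ e₁ (by omega)
  obtain ⟨q', -, hq'⟩ := hsplit h₁' e₂' (by omega)
  have hq : q = FreeGroup.invRev q' ++ (X.prefixN m)⁻¹.toWord := by
    rw [← FreeGroup.invRev_invRev (L₁ := q), hq', FreeGroup.invRev_append, FreeGroup.toWord_inv]
  have hne : ∀ Z : InfWord ι, Z.prefixN m ≠ 1 := fun Z e => by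
    have := Z.length_prefixN m
    rw [e, FreeGroup.toWord_one, List.length_nil] at this
    omega
  obtain ⟨f₁, f₂, f₃⟩ := isCyclicallyReduced_of_conj (x := X.prefixN m) (y := Y.prefixN m)
    (c := v n * g * (s * (u n)⁻¹)) (R := p' ++ FreeGroup.invRev q')
    (by rw [InfWord.toWord_inv_mul_prefixN hXY, FreeGroup.toWord_inv])
    (hne X) (hne Y) (by simp [hp']) (by rw [e₃, hq]; simp only [List.append_assoc])
  refine ⟨1, FreeGroup.mk (p' ++ FreeGroup.invRev q'), ?_, ?_, ?_⟩
  · rw [one_mul, f₁, FreeGroup.toWord_one, List.nil_append]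
  · rwa [one_mul]
  · rw [one_mul, f₃]
    refine (translationLengthOn_le (St.invariant ((X.prefixN m)⁻¹ * u n) _ hP)).trans_lt ?_
    have : dist (((X.prefixN m)⁻¹ * u n) • P) (((X.prefixN m)⁻¹ * (v n * g * (s * (u n)⁻¹)) *
        X.prefixN m) • ((X.prefixN m)⁻¹ * u n) • P) = dist (u n • P) (v n • g • s • P) := by
      rw [← dist_smul (X.prefixN m)⁻¹ (u n • P)]
      simp only [← mul_smul]
      congr 2; group
    rw [this]
    have t₁ := dist_triangle_right (u n • P) (v n • g • s • P) Q
    have t₂ := dist_triangle (v n • g • s • P) (v n • P') Q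
    have t₃ := dist_triangle_right (g • s • P) P' (g • P)
    have t₄ : dist (g • s • P) (g • P) = dist P (s • P) := by rw [dist_smul, dist_comm]
    rw [dist_smul] at t₂
    rw [dist_comm P'] at t₃
    linarith

theorem leavesCarried_of_dualLanguageOn_subset (hK : IsCompact K) (hT : St.Tsub.Nontrivial)
    (h : dualLanguageOn ι St.Tsub ⊆ inducedAdmLanguage St K) : LeavesCarried St K := by
  intro X Y Q hXY hX hY
  have key : ∀ m : ℕ, ∃ z, ∀ n ≤ m + 1, z ∈ X.prefixN n • K ∧ z ∈ Y.prefixN n • K := by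
    intro m
    obtain ⟨v, ⟨z, hz⟩, p, s, hp, hs, hv⟩ :=
      h (inv_mul_mem_dualLanguageOn hT hXY hX hY (show 1 ≤ m + 1 by omega)) 0
    obtain rfl := List.length_eq_zero_iff.1 hp
    obtain rfl := List.length_eq_zero_iff.1 hs
    rw [List.nil_append, List.append_nil] at hv
    obtain rfl := FreeGroup.toWord_injective hv
    have hz' : ∀ n ≤ 2 * (m + 1),
        z ∈ gprefix ((X.prefixN (m + 1))⁻¹ * Y.prefixN (m + 1)) n • K := fun n hn => by
      refine mem_iInter₂.1 hz n (Finset.mem_range.2 ?_)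
      rw [InfWord.toWord_inv_mul_prefixN hXY, List.length_append, FreeGroup.invRev_length,
        InfWord.length_prefixN, InfWord.length_prefixN]
      omega
    refine ⟨X.prefixN (m + 1) • z, fun n hn => ⟨?_, ?_⟩⟩
    · have e : X.prefixN n = X.prefixN (m + 1) *
          gprefix ((X.prefixN (m + 1))⁻¹ * Y.prefixN (m + 1)) (m + 1 - n) := by
        have hl : (FreeGroup.invRev ((X.prefixN (m + 1)).toWord.drop n)).length = m + 1 - n := by
          simp
        have hX : FreeGroup.invRev (X.prefixN (m + 1)).toWord =
            FreeGroup.invRev ((X.prefixN (m + 1)).toWord.drop n) ++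
              FreeGroup.invRev (X.prefixN n).toWord := by
          rw [← X.take_toWord_prefixN hn, ← FreeGroup.invRev_append, List.take_append_drop]
        have hp : X.prefixN (m + 1) =
            X.prefixN n * FreeGroup.mk ((X.prefixN (m + 1)).toWord.drop n) := by
          conv_lhs => rw [← mk_take_mul_mk_drop (X.prefixN (m + 1)) n]
          rw [X.take_toWord_prefixN hn, FreeGroup.mk_toWord]
        rw [gprefix, InfWord.toWord_inv_mul_prefixN hXY, hX, List.append_assoc,
          List.take_append_of_le_length hl.ge, List.take_of_length_le hl.le, ← FreeGroup.inv_mk,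
          eq_mul_inv_iff_mul_eq]
        exact hp.symm
      rw [e, mul_smul]
      exact smul_mem_smul_set (hz' _ (by omega))
    · have e : Y.prefixN n = X.prefixN (m + 1) *
          gprefix ((X.prefixN (m + 1))⁻¹ * Y.prefixN (m + 1)) (m + 1 + n) := by
        have hl : (FreeGroup.invRev (X.prefixN (m + 1)).toWord).length = m + 1 := by simp
        rw [gprefix, InfWord.toWord_inv_mul_prefixN hXY, List.take_append, hl,
          List.take_of_length_le (by rw [hl]; omega), Nat.add_sub_cancel_left,
          Y.take_toWord_prefixN hn, mk_append, FreeGroup.mk_toWord, ← FreeGroup.inv_mk,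
          FreeGroup.mk_toWord, mul_inv_cancel_left]
      rw [e, mul_smul]
      exact smul_mem_smul_set (hz' _ (by omega))
  choose z hz using key
  have hz₀ : ∀ m, z m ∈ K := fun m => by simpa using (hz m 0 (by omega)).1
  obtain ⟨R, -, φ, hφ, hR⟩ := hK.tendsto_subseq hz₀
  refine ⟨R, fun n => ⟨?_, ?_⟩⟩
  all_goals
    refine (hK.smul _).isClosed.mem_of_tendsto hR ?_
    filter_upwards [hφ.tendsto_atTop.eventually_ge_atTop n] with k hk
  · exact (hz _ n (by omega)).1
  · exact (hz _ n (by omega)).2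

end Leaves

/-! ### Consequences of the minimal subtree being isometric to `T` -/

section Isometry

variable {ι : Type} {St : TreeSetup ι} {K : Set St.Tb} {IA : InducedAssoc St K}

theorem PathLE.nsmul_le_of_infix {L B : List (ι × Bool)} {δ : ℝ} (hL : L <:+: B)
    (h : ∀ x y, ¬ PathLE K L x y δ) (n : ℕ) {x y : K} {r : ℝ}
    (hp : PathLE K (List.replicate n B).flatten x y r) : n * δ ≤ r := by
  induction n generalizing x r with
  | zero => simpa using hp.nonneg
  | succ n ih =>
    rw [List.replicate_succ, List.flatten_cons] at hp
    obtain ⟨m, s, h₁, h₂⟩ := PathLE.append_iff.1 hp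
    obtain ⟨p, q, rfl⟩ := hL
    obtain ⟨x', y', h₃⟩ := h₁.of_append
    have hs : δ ≤ s := le_of_not_gt fun hs => h _ _ (h₃.mono hs.le)
    have := ih h₂
    push_cast
    linarith

theorem mk_flatten_replicate (L : List (ι × Bool)) (n : ℕ) :
    FreeGroup.mk (List.replicate n L).flatten = FreeGroup.mk L ^ n :=
  (FreeGroup.pow_mk n).symm

theorem dist_pow_smul_le {X G : Type*} [MetricSpace X] [Group G] [MulAction G X]
    [IsIsometricSMul G X] (g : G) (x : X) (n : ℕ) : dist x (g ^ n • x) ≤ n * dist x (g • x) := by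
  induction n with
  | zero => simp
  | succ n ih =>
    rw [pow_succ', mul_smul]
    refine (dist_triangle _ (g • x) _).trans ?_
    rw [dist_smul]
    push_cast
    linarith

variable [DecidableEq ι]

theorem eventually_not_pathLE (hK : IsCompact K) {w : FreeGroup ι}
    (hw : ¬ InducedAdmissible St K w) :
    ∀ᶠ δ in 𝓝[>] (0 : ℝ), ∀ x y, ¬ PathLE K w.toWord x y δ := by
  by_contra hcon
  rw [not_eventually] at hcon
  obtain ⟨x, y, h⟩ := PathLE.exists_zero_of_forall_pos (L := w.toWord) hK fun δ hδ => by
    obtain ⟨δ', h, -, hδ'⟩ := (hcon.and_eventually (Ioc_mem_nhdsGT hδ)).exists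
    push Not at h
    obtain ⟨x, y, h⟩ := h
    exact ⟨x, y, h.mono hδ'⟩
  exact hw ⟨x, mem_iInter₂.2 fun n _ => h.mem_of_zero n⟩

theorem IsCyclicallyReduced.isCyclicallyReduced_toWord {c : FreeGroup ι}
    (hc : IsCyclicallyReduced c) : FreeGroup.IsCyclicallyReduced c.toWord :=
  ⟨FreeGroup.isReduced_toWord, fun a ha b hb =>
    not_lettersInv_iff.1 (not_lettersInv_comm.1 (hc.2 b hb a ha))⟩

/-- A cyclically reduced word with an infix of positive cost moves every point. -/
theorem le_dist_smul_of_infix (hK : IsCompact K)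
    (hKa : ∀ i : ι, (K ∩ FreeGroup.of i • K).Nonempty) {L B : List (ι × Bool)} {δ : ℝ}
    (hB : FreeGroup.IsCyclicallyReduced B) (hL : L <:+: B) (h : ∀ x y, ¬ PathLE K L x y δ)
    (p : IA.TK) : δ ≤ dist p (FreeGroup.mk B • p) := by
  obtain ⟨g, x, rfl⟩ := IA.orbit_meets p
  set b := FreeGroup.mk B with hb
  obtain ⟨C, hC⟩ := PathLE.exists_of_letters (exists_letter hKa) g.toWord x x
  have hpath : ∀ n : ℕ, n * δ ≤ 2 * C + n * dist (g • IA.emb x) (b • g • IA.emb x) := by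
    intro n
    have h₁ := (hC.append (pathLE_dist (IA := IA) hK hKa g (b ^ n * g) x x)).append hC.symm
    have hw : FreeGroup.reduce (g.toWord ++ (g⁻¹ * (b ^ n * g)).toWord ++
        FreeGroup.invRev g.toWord) = (List.replicate n B).flatten := by
      rw [← toWord_mk_of_isReduced (hB.flatten_replicate n).isReduced, mk_flatten_replicate, ← hb,
        ← FreeGroup.toWord_mk, mk_append, mk_append, FreeGroup.mk_toWord, FreeGroup.mk_toWord,
        ← FreeGroup.inv_mk, FreeGroup.mk_toWord]
      congr 1; group
    have h₂ := (hw ▸ h₁.red FreeGroup.reduce.red).nsmul_le_of_infix hL h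
    have h₃ := dist_pow_smul_le b (g • IA.emb x) n
    rw [mul_smul] at h₂
    linarith
  by_contra! hlt
  obtain ⟨n, hn⟩ := exists_nat_gt (2 * C / (δ - dist (g • IA.emb x) (b • g • IA.emb x)))
  rw [div_lt_iff₀ (by linarith)] at hn
  linarith [hpath n]

theorem dualLanguageOn_subset_of_isometry [Finite ι] (hK : IsCompact K)
    (hKa : ∀ i : ι, (K ∩ FreeGroup.of i • K).Nonempty)
    (hd : ∀ p ∈ minSubtree (FreeGroup ι) IA.TK, ∀ q ∈ minSubtree (FreeGroup ι) IA.TK,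
      dist (IA.jmap p) (IA.jmap q) = dist p q)
    (hT : IA.jmap '' minSubtree (FreeGroup ι) IA.TK = St.Tsub) :
    dualLanguageOn ι St.Tsub ⊆ inducedAdmLanguage St K := by
  intro v hv k
  by_contra! hcon
  have hev : ∀ᶠ δ in 𝓝[>] (0 : ℝ),
      ∀ w ∈ {w : FreeGroup ι | w.toWord.length ≤ k + v.toWord.length + k ∧
        ¬ InducedAdmissible St K w}, ∀ x y, ¬ PathLE K w.toWord x y δ :=
    (eventually_all_finite ((finite_length_le _).subset fun _ hw => hw.1)).2
      fun w hw => eventually_not_pathLE hK hw.2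
  obtain ⟨δ, hδ, hδ₀ : 0 < δ⟩ := (hev.and self_mem_nhdsWithin).exists
  obtain ⟨u, w, hc, hcyc, hlen⟩ := hv (δ / (2 * k + 1)) (by positivity)
  set c := u * v * w with hcdef
  have : Nonempty St.Tsub := St.nonempty.to_subtype
  obtain ⟨⟨P, hP⟩, hPc⟩ := exists_lt_of_ciInf_lt hlen
  obtain ⟨p, hp, rfl⟩ := hT ▸ hP
  have hcp : c • p ∈ minSubtree (FreeGroup ι) IA.TK := fun A hA => hA.2.2 _ _ (hp A hA)
  replace hPc : dist p (c • p) < δ / (2 * k + 1) := by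
    rwa [← hd _ hp _ hcp, IA.jmap_equivariant]
  have hcyc' := hcyc.isCyclicallyReduced_toWord
  have hclen : 1 ≤ c.toWord.length := by
    rw [Nat.one_le_iff_ne_zero, Ne, List.length_eq_zero_iff, FreeGroup.toWord_eq_nil_iff]
    exact hcyc.1
  set A := (List.replicate k c.toWord).flatten with hA
  have hAlen : k ≤ A.length := by
    rw [hA, List.length_flatten, List.map_replicate, List.sum_replicate, smul_eq_mul]
    exact Nat.le_mul_of_pos_right _ hclen
  have hB : (List.replicate (2 * k + 1) c.toWord).flatten = A ++ c.toWord ++ A := by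
    rw [show 2 * k + 1 = k + 1 + k by omega, List.replicate_add, List.replicate_add,
      List.flatten_append, List.flatten_append]
    simp [hA]
  set s₁ := (A ++ u.toWord).drop (A.length + u.toWord.length - k) with hs₁
  set s₂ := (w.toWord ++ A).take k with hs₂
  have hinf : s₁ ++ v.toWord ++ s₂ <:+: A ++ c.toWord ++ A := by
    refine ⟨(A ++ u.toWord).take (A.length + u.toWord.length - k), (w.toWord ++ A).drop k, ?_⟩
    calc _ = ((A ++ u.toWord).take (A.length + u.toWord.length - k) ++ s₁) ++ v.toWord ++
          (s₂ ++ (w.toWord ++ A).drop k) := by simp only [List.append_assoc]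
      _ = _ := by
        rw [List.take_append_drop, List.take_append_drop, hc]
        simp only [List.append_assoc]
  have hBcyc := hcyc'.flatten_replicate (2 * k + 1)
  have hl₁ : s₁.length = k := by
    rw [hs₁, List.length_drop, List.length_append]; omega
  have hl₂ : s₂.length = k := by
    rw [hs₂, List.length_take, List.length_append]; omega
  have hw := toWord_mk_of_isReduced ((hB ▸ hBcyc.isReduced).infix hinf)
  have hle := le_dist_smul_of_infix hK hKa hBcyc (hB ▸ hinf) (p := p) (fun x y h => by
    refine hδ (FreeGroup.mk (s₁ ++ v.toWord ++ s₂)) ⟨?_, fun hadm => ?_⟩ x y (hw.symm ▸ h)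
    · rw [hw, List.length_append, List.length_append, hl₁, hl₂]
    · exact hcon _ hadm s₁ s₂ hl₁ hl₂ hw)
  rw [mk_flatten_replicate, FreeGroup.mk_toWord] at hle
  have := hle.trans (dist_pow_smul_le c p (2 * k + 1))
  rw [lt_div_iff₀ (by positivity)] at hPc
  push_cast at this
  linarith

theorem limitSet_subset_of_isometry (hK : IsCompact K)
    (hKa : ∀ i : ι, (K ∩ FreeGroup.of i • K).Nonempty)
    (hd : ∀ p ∈ minSubtree (FreeGroup ι) IA.TK, ∀ q ∈ minSubtree (FreeGroup ι) IA.TK,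
      dist (IA.jmap p) (IA.jmap q) = dist p q)
    (hT : IA.jmap '' minSubtree (FreeGroup ι) IA.TK = St.Tsub) : limitSet St ⊆ K := by
  rintro Q ⟨X, Y, hXY, ⟨P, hP, u, hu, hPQ⟩, ⟨P', hP', v, hv, hPQ'⟩⟩
  obtain ⟨p, hp, rfl⟩ := hT ▸ hP
  obtain ⟨p', hp', rfl⟩ := hT ▸ hP'
  have hinv : ∀ (g : FreeGroup ι), ∀ p ∈ minSubtree (FreeGroup ι) IA.TK,
      g • p ∈ minSubtree (FreeGroup ι) IA.TK := fun g p hp A hA => hA.2.2 _ _ (hp A hA)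
  obtain ⟨g, x, rfl⟩ := IA.orbit_meets p
  obtain ⟨g', x', rfl⟩ := IA.orbit_meets p'
  have hev := (hu.mul_right g).eventually_toWord_inv_mul (hv.mul_right g') hXY
  have hdist : Tendsto (fun n => dist (u n • IA.jmap (g • IA.emb x)) Q +
      dist (v n • IA.jmap (g' • IA.emb x')) Q) atTop (𝓝 0) := by
    simpa using (tendsto_iff_dist_tendsto_zero.1 hPQ).add (tendsto_iff_dist_tendsto_zero.1 hPQ')
  rw [← hK.isClosed.closure_eq, Metric.mem_closure_iff]
  intro ε hε
  obtain ⟨n, hn, hε'⟩ := (hev.and (hdist.eventually_lt_const (half_pos hε))).exists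
  have hpath := pathLE_dist (IA := IA) hK hKa (u n * g) (v n * g') x x'
  rw [hn] at hpath
  obtain ⟨m, s, hm, hm'⟩ := PathLE.append_iff.1 hpath
  refine ⟨m, m.2, ?_⟩
  have hm₁ := hm.dist_le
  have hm₂ := hm'.nonneg
  rw [← FreeGroup.inv_mk, FreeGroup.mk_toWord, dist_comm, dist_smul_inv, mul_smul,
    ← jmap_smul_emb (IA := IA), dist_comm] at hm₁
  rw [mul_smul, mul_smul, ← hd _ (hinv _ _ hp) _ (hinv _ _ hp'), IA.jmap_equivariant,
    IA.jmap_equivariant (v n)] at hm₂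
  have t₁ := dist_triangle_right (u n • IA.jmap (g • IA.emb x)) (v n • IA.jmap (g' • IA.emb x')) Q
  have t₂ := dist_triangle_left Q (m : St.Tb) (u n • IA.jmap (g • IA.emb x))
  have t₃ := dist_nonneg (x := v n • IA.jmap (g' • IA.emb x')) (y := Q)
  linarith

end Isometry

section Degenerate

variable {ι : Type} {St : TreeSetup ι} {K : Set St.Tb} {IA : InducedAssoc St K}

theorem subsingleton_of_not_nontrivial (hT : ¬ St.Tsub.Nontrivial) : Subsingleton St.Tb := by
  have h := (not_nontrivial_iff.1 hT).closure
  rw [St.dense.closure_eq] at h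
  exact subsingleton_univ_iff.1 h

theorem subsingleton_TK [Subsingleton St.Tb] : Subsingleton IA.TK := by
  have hfix : ∀ (g : FreeGroup ι) (x : K), g • IA.emb x = IA.emb x := fun g x => by
    have hof : ∀ i, (FreeGroup.of i)⁻¹ • IA.emb x = IA.emb x := fun i => by
      rw [IA.compat i x (by rw [Subsingleton.elim ((FreeGroup.of i)⁻¹ • (x : St.Tb)) x]; exact x.2)]
      exact congrArg _ (Subsingleton.elim _ _)
    induction g using FreeGroup.induction_on with
    | C1 => exact one_smul _ _
    | of i => exact (inv_smul_eq_iff.1 (hof i)).symm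
    | inv_of i _ => exact hof i
    | mul g h hg hh => rw [mul_smul, hh, hg]
  refine ⟨fun p q => ?_⟩
  obtain ⟨g, x, rfl⟩ := IA.orbit_meets p
  obtain ⟨h, y, rfl⟩ := IA.orbit_meets q
  rw [hfix, hfix, Subsingleton.elim x y]

theorem isometry_minSubtree_of_subsingleton [Subsingleton St.Tb] (hK : K.Nonempty) :
    (∀ p ∈ minSubtree (FreeGroup ι) IA.TK, ∀ q ∈ minSubtree (FreeGroup ι) IA.TK,
      dist (IA.jmap p) (IA.jmap q) = dist p q) ∧
    IA.jmap '' minSubtree (FreeGroup ι) IA.TK = St.Tsub := by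
  have := subsingleton_TK (IA := IA)
  obtain ⟨x, hx⟩ := hK
  have hne : (minSubtree (FreeGroup ι) IA.TK).Nonempty := by
    refine ⟨IA.emb ⟨x, hx⟩, ?_⟩
    rintro A ⟨⟨a, ha⟩, -⟩
    rwa [Subsingleton.elim (IA.emb ⟨x, hx⟩) a]
  refine ⟨fun p _ q _ => ?_, ?_⟩
  · rw [Subsingleton.elim p q, dist_self, dist_self]
  · rw [Subsingleton.eq_univ_of_nonempty (hne.image _),
      Subsingleton.eq_univ_of_nonempty St.nonempty]

end Degenerate

/-- **Theorem 5.5 (Main Theorem).**  Let `T` be an ℝ-tree with a very small, minimal,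
isometric action of `F_N` (`N ≥ 2`) with dense orbits, `𝒜` a basis of `F_N`, and
`K ⊆ T̄` a compact subtree with `K ∩ aK ≠ ∅` for every `a ∈ 𝒜`.  The following are
equivalent: (1) the restriction of `j : T_𝒦 → T̄` to the minimal invariant subtree
`T_𝒦^min` is an isometry onto `T`; (2) `ℒ_𝒜(T) ⊆ ℒ_adm(𝒦)`; (3) `Ω_𝒜 ⊆ K`. -/
theorem main_theorem {ι : Type} [Fintype ι] [DecidableEq ι] (hrank : 2 ≤ Fintype.card ι)
    (St : TreeSetup ι) (K : Set St.Tb)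
    (hKcomp : IsCompact K) (hKtree : IsClosedSubtree K)
    (hKa : ∀ i : ι, (K ∩ FreeGroup.of i • K).Nonempty)
    (IA : InducedAssoc St K) :
    (((∀ p ∈ minSubtree (FreeGroup ι) IA.TK, ∀ q ∈ minSubtree (FreeGroup ι) IA.TK,
          dist (IA.jmap p) (IA.jmap q) = dist p q) ∧
        IA.jmap '' minSubtree (FreeGroup ι) IA.TK = St.Tsub) ↔
      dualLanguageOn ι St.Tsub ⊆ inducedAdmLanguage St K) ∧
    ((dualLanguageOn ι St.Tsub ⊆ inducedAdmLanguage St K) ↔ limitSet St ⊆ K) := by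
  have : Nontrivial ι := Fintype.one_lt_card_iff_nontrivial.1 hrank
  have h₁₂ := dualLanguageOn_subset_of_isometry (IA := IA) hKcomp hKa
  have h₁₃ := limitSet_subset_of_isometry (IA := IA) hKcomp hKa
  by_cases hT : St.Tsub.Nontrivial
  · have h₂ := leavesCarried_of_dualLanguageOn_subset hKcomp hT
    have h := isometry_minSubtree_of_leavesCarried (IA := IA) hKcomp hKa hT
    refine ⟨⟨fun h₁ => h₁₂ h₁.1 h₁.2, fun h' => h (h₂ h')⟩,
      ⟨fun h' => h₁₃ (h (h₂ h')).1 (h (h₂ h')).2, fun h' => ?_⟩⟩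
    have h₁ := h (leavesCarried_of_limitSet_subset h')
    exact h₁₂ h₁.1 h₁.2
  · have := subsingleton_of_not_nontrivial hT
    have h₁ := isometry_minSubtree_of_subsingleton (IA := IA) hKtree.1
    have h₂ := h₁₂ h₁.1 h₁.2
    exact ⟨iff_of_true h₁ h₂, iff_of_true h₂ (h₁₃ h₁.1 h₁.2)⟩

end CHL
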